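/- arXiv:1607.07164 — 5 statements merged into one kernel-verified Lean document; each statement's English description precedes it below -/
import Mathlib

section
/- If S is a set of positive integers almost closed under addition and the indicator function k ↦ 1_S(k) is computable, then there exists a computable basic sequence Q which is infinite in limit and a computable real number belonging to RN^{I}(Q) ∩ RN^{II}(Q) ∩ N^{I}_{Ab}(Q) ∩ ⋂_{k∈S} N_k(Q) \ (N^{II}(Q) ∪ ⋃_{k∉S} N_k(Q)). -/
open Filter MeasureTheory Finset
open scoped Topology Classical

/-- A basic sequence: a sequence of integers, each at least `2`. -/
def IsBasic (q : ℕ → ℕ) : Prop := ∀ n, 2 ≤ q n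

/-- The product `q_0 q_1 ⋯ q_{n-1}` of the first `n` terms of the basic sequence. -/
def qprod (q : ℕ → ℕ) (n : ℕ) : ℝ := ∏ i ∈ Finset.range n, (q i : ℝ)

/-- `T_{Q,n}(x) = (q_0 q_1 ⋯ q_{n-1}) x mod 1`. -/
noncomputable def TQ (q : ℕ → ℕ) (n : ℕ) (x : ℝ) : ℝ := Int.fract (qprod q n * x)

/-- The `n`-th digit `E_n` of the `Q`-Cantor series expansion of `x`
(digit positions are indexed by `0, 1, 2, …`). -/
noncomputable def qdigit (q : ℕ → ℕ) (x : ℝ) (n : ℕ) : ℕ := ⌊(q n : ℝ) * TQ q n x⌋₊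

/-- `N_n^Q(B,x)`: the number of occurrences of the block `B` starting among the first `n`
digit positions of the `Q`-Cantor series expansion of `x`. -/
noncomputable def blockCount (q : ℕ → ℕ) (x : ℝ) {k : ℕ} (B : Fin k → ℕ) (n : ℕ) : ℕ :=
  ((Finset.range n).filter fun i => ∀ j : Fin k, qdigit q x (i + (j : ℕ)) = B j).card

/-- `Q_n^{(k)} = ∑_{j<n} 1/(q_j q_{j+1} ⋯ q_{j+k-1})`. -/
noncomputable def Qsum (q : ℕ → ℕ) (k n : ℕ) : ℝ :=
  ∑ j ∈ Finset.range n, (∏ i ∈ Finset.range k, (q (j + i) : ℝ))⁻¹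

/-- `x` is `Q`-normal of order `k`: every block of length `k` occurs with the expected
asymptotic frequency. -/
def QNormalOfOrder (q : ℕ → ℕ) (k : ℕ) (x : ℝ) : Prop :=
  ∀ B : Fin k → ℕ,
    Tendsto (fun n => (blockCount q x B n : ℝ) / Qsum q k n) atTop (𝓝 1)

/-- `x ∈ N(Q)`: `x` is `Q`-normal of every order `k ≥ 1`. -/
def QNormal (q : ℕ → ℕ) (x : ℝ) : Prop := ∀ k, 1 ≤ k → QNormalOfOrder q k x

/-- `Q` is fully divergent: `Q_n^{(k)} → ∞` for every `k ≥ 1`. -/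
def FullyDivergent (q : ℕ → ℕ) : Prop :=
  ∀ k, 1 ≤ k → Tendsto (fun n => Qsum q k n) atTop atTop

/-- `Q` is infinite in limit: `q_n → ∞`. -/
def InfiniteInLimit (q : ℕ → ℕ) : Prop := Tendsto q atTop atTop

/-- `N_{n,m,r}^Q(B,x)`: occurrences of the block `B` (of length `m`) starting at
positions `i < n` with `i ≡ r (mod m)`. -/
noncomputable def apCount (q : ℕ → ℕ) (x : ℝ) (m r : ℕ) (B : Fin m → ℕ) (n : ℕ) : ℕ :=
  ((Finset.range n).filter fun i =>
    i % m = r ∧ ∀ j : Fin m, qdigit q x (i + (j : ℕ)) = B j).card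

/-- `Q_n^{(m,r)} = ∑_{j=0}^{⌊(n-r)/m⌋} 1/(q_{mj+r} q_{mj+r+1} ⋯ q_{mj+r+m-1})`. -/
noncomputable def apQsum (q : ℕ → ℕ) (m r n : ℕ) : ℝ :=
  ∑ j ∈ Finset.range ((n - r) / m + 1),
    (∏ i ∈ Finset.range m, (q (m * j + r + i) : ℝ))⁻¹

/-- `x ∈ N^{I}_{m,r}(Q)`. -/
def MemNAPI (q : ℕ → ℕ) (m r : ℕ) (x : ℝ) : Prop :=
  ∀ B : Fin m → ℕ,
    Tendsto (fun n => (apCount q x m r B n : ℝ) / apQsum q m r n) atTop (𝓝 1)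

/-- `x ∈ N^{I}_{Ab}(Q)`: `x` is AP `Q`-abnormal of type I. -/
def APAbnormalI (q : ℕ → ℕ) (x : ℝ) : Prop :=
  ∀ m, 2 ≤ m → ∀ r, r < m → ¬ MemNAPI q m r x

/-- `x ∈ RN^{I}(Q)`. -/
def MemRNI (q : ℕ → ℕ) (x : ℝ) : Prop :=
  ∀ m, 1 ≤ m → ∀ r, r < m → ∀ B₁ B₂ : Fin m → ℕ,
    Tendsto (fun n => (apCount q x m r B₁ n : ℝ) / (apCount q x m r B₂ n : ℝ))
      atTop (𝓝 1)

/-- `Λ_{m,r}(Q) = (q_{mt+r})_t`. -/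
def lamQ (q : ℕ → ℕ) (m r : ℕ) : ℕ → ℕ := fun t => q (m * t + r)

/-- `Υ_{Q,m,r}(x)`: the real number whose `Λ_{m,r}(Q)`-Cantor series digits are
`(E_{mt+r})_t`, where `(E_n)` are the `Q`-Cantor series digits of `x`. -/
noncomputable def Ups (q : ℕ → ℕ) (m r : ℕ) (x : ℝ) : ℝ :=
  ∑' t : ℕ, (qdigit q x (m * t + r) : ℝ) / ∏ i ∈ Finset.range (t + 1), (lamQ q m r i : ℝ)

/-- `x ∈ N^{II}_{k,m,r}(Q) = Υ_{Q,m,r}^{-1}(N_k(Λ_{m,r}(Q)))`. -/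
def MemNAPII (q : ℕ → ℕ) (k m r : ℕ) (x : ℝ) : Prop :=
  QNormalOfOrder (lamQ q m r) k (Ups q m r x)

/-- `x ∈ N^{II}(Q)`: `x` is AP `Q`-normal of type II. -/
def APNormalII (q : ℕ → ℕ) (x : ℝ) : Prop :=
  ∀ k, 1 ≤ k → ∀ m, 1 ≤ m → ∀ r, r < m → MemNAPII q k m r x

/-- `x ∈ RN^{II}(Q)`: for all `k, m, r` the counts in `Υ_{Q,m,r}(x)` of any two blocks of
length `k` with respect to `Λ_{m,r}(Q)` have ratio tending to `1`. -/
def MemRNII (q : ℕ → ℕ) (x : ℝ) : Prop :=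
  ∀ k, 1 ≤ k → ∀ m, 1 ≤ m → ∀ r, r < m → ∀ B₁ B₂ : Fin k → ℕ,
    Tendsto (fun n =>
      (blockCount (lamQ q m r) (Ups q m r x) B₁ n : ℝ) /
      (blockCount (lamQ q m r) (Ups q m r x) B₂ n : ℝ)) atTop (𝓝 1)

/-- `S` (a set of positive integers) is almost closed under addition: for every `k ∈ S`,
the set `{x ∉ S : x + k ∈ S}` has asymptotic density `0`. -/
def AlmostClosed (S : Set ℕ) : Prop :=
  ∀ k ∈ S, Tendsto
    (fun t : ℕ => (((Finset.Icc 1 t).filter fun x => x ∉ S ∧ x + k ∈ S).card : ℝ) / t)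
    atTop (𝓝 0)

/-- The sequence `u` of reals is uniformly distributed mod 1. -/
def UDMod1 (u : ℕ → ℝ) : Prop :=
  ∀ a b : ℝ, 0 ≤ a → a < b → b ≤ 1 →
    Tendsto (fun N => (((Finset.range N).filter fun n => u n ∈ Set.Ico a b).card : ℝ) / N)
      atTop (𝓝 (b - a))

/-- `x ∈ DN(Q)`: `x` is `Q`-distribution normal. -/
def DistNormal (q : ℕ → ℕ) (x : ℝ) : Prop := UDMod1 fun n => TQ q n x

/-- `x ∈ DN_{Ab}(Q)`: `x` is AP `Q`-distribution abnormal. -/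
def APDistAbnormal (q : ℕ → ℕ) (x : ℝ) : Prop :=
  ∀ m, 2 ≤ m → ∀ r, r < m → ¬ UDMod1 fun n => TQ q (m * n + r) x

/-- `y ∈ D_{(x_n)}(Q)`: for every `ξ ∈ (0,1)`, the proportion of `n ≤ N` with
`fract (T_{Q,n}(y) - x_n) < ξ` tends to `1`. -/
def MemD (q : ℕ → ℕ) (xs : ℕ → ℝ) (y : ℝ) : Prop :=
  ∀ ξ : ℝ, 0 < ξ → ξ < 1 →
    Tendsto (fun N =>
      (((Finset.range N).filter fun n => Int.fract (TQ q n y - xs n) < ξ).card : ℝ) / N)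
      atTop (𝓝 1)

/-- A computable real number. -/
def ComputableReal (x : ℝ) : Prop :=
  ∃ f : ℕ → ℕ, Computable f ∧ ∀ n : ℕ, 0 < n → (f n : ℝ) / n ≤ x ∧ x ≤ ((f n : ℝ) + 1) / n

/-- The indicator function `1_{ℕ∖S}` of the complement of `S`, with values in `ℤ`. -/
noncomputable def indZ (S : Set ℕ) (i : ℕ) : ℤ := if i ∈ S then 0 else 1

/-- The indicator function `1_{ℕ∖S}` of the complement of `S`, with values in `ℝ`. -/
noncomputable def indR (S : Set ℕ) (i : ℕ) : ℝ := if i ∈ S then 0 else 1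

/-- The coefficients `c_{t,i}`: `c_{t,1} = t (1+ε)^{1_{ℕ∖S}(1)}` and
`c_{t,i} = (1+ε)^{1_{ℕ∖S}(i) - 1_{ℕ∖S}(i-1)}` for `i ≥ 2`. -/
noncomputable def coeff (S : Set ℕ) (ε : ℝ) (t i : ℕ) : ℝ :=
  if i = 1 then (t : ℝ) * (1 + ε) ^ indZ S 1
  else (1 + ε) ^ (indZ S i - indZ S (i - 1))

/-- `N_k(b)`: the set of real numbers normal of order `k` in base `b`. -/
def BaseNormalOfOrder (b k : ℕ) : Set ℝ :=
  {x | ∀ B : Fin k → ℕ, (∀ j, B j < b) →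
    Tendsto (fun n => (blockCount (fun _ => b) x B n : ℝ) / n) atTop
      (𝓝 (((b : ℝ) ^ k)⁻¹))}

namespace CellSeq

/-- The stage containing sweep `s`; stage `t` consists of the sweeps `t², …, (t+1)² - 1`. -/
def stage (s : ℕ) : ℕ := Nat.sqrt s

/-- The word length used in sweep `s`. -/
def len (s : ℕ) : ℕ := s - stage s * stage s

/-- The alphabet size used in sweep `s`. -/
def base (s : ℕ) : ℕ := stage s + 2

/-- The growth parameter of stage `t`. -/
def growth (t : ℕ) : ℕ := (t + 3) ^ (2 * t + 7)

/-- The number of times each word is listed in sweep `s`. -/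
def mult (s : ℕ) : ℕ := growth (stage s) ^ (2 * stage s + 1 - len s)

/-- The number of cells of sweep `s`. -/
def runs (s : ℕ) : ℕ := mult s * base s ^ len s

/-- The length of a cell of sweep `s`. -/
def gap (s : ℕ) : ℕ := (s + 3).factorial

/-- The first position of sweep `s`. -/
def start : ℕ → ℕ
  | 0 => 0
  | s + 1 => (start s + runs s * gap s) * (s + 1).factorial

/-- The sweep containing position `i`. -/
def idx : ℕ → ℕ
  | 0 => 0
  | i + 1 => if start (idx i + 1) ≤ i + 1 then idx i + 1 else idx i

/-- The number of the cell containing position `i`, within its sweep. -/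
def cell (i : ℕ) : ℕ := (i - start (idx i)) / gap (idx i)

/-- The offset of position `i` within its cell. -/
def off (i : ℕ) : ℕ := (i - start (idx i)) % gap (idx i)

/-- The digit sequence: cell `u` of a sweep lists the base-`b` digits of `u`, followed by the
filler digit `b`. -/
def digit (i : ℕ) : ℕ :=
  if cell i < runs (idx i) ∧ off i < len (idx i) then
    cell i / base (idx i) ^ off i % base (idx i)
  else base (idx i)

/-- The basic sequence attached to an indicator function `χ`. -/
def bseq (χ : ℕ → ℕ) (i : ℕ) : ℕ :=
  if cell i < runs (idx i) ∧ 1 ≤ off i ∧ off i ≤ len (idx i) then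
    (base (idx i) + 2) * (2 - χ (len (idx i)))
  else (i + 4).factorial

lemma stage_sq_le (s : ℕ) : stage s * stage s ≤ s := Nat.sqrt_le s

lemma lt_succ_stage_sq (s : ℕ) : s < (stage s + 1) * (stage s + 1) := Nat.lt_succ_sqrt s

lemma len_le_two_stage (s : ℕ) : len s ≤ 2 * stage s := by
  have := lt_succ_stage_sq s
  unfold len
  have : (stage s + 1) * (stage s + 1) = stage s * stage s + 2 * stage s + 1 := by ring
  omega

lemma len_le (s : ℕ) : len s ≤ s := Nat.sub_le _ _

lemma stage_eq {t l : ℕ} (h : l ≤ 2 * t) : stage (t * t + l) = t := by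
  unfold stage
  symm
  rw [Nat.eq_sqrt]
  constructor
  · omega
  · nlinarith

lemma len_eq {t l : ℕ} (h : l ≤ 2 * t) : len (t * t + l) = l := by
  unfold len; rw [stage_eq h]; omega

lemma stage_mono : Monotone stage := fun _ _ h => Nat.sqrt_le_sqrt h

lemma tendsto_stage : Tendsto stage atTop atTop := by
  refine tendsto_atTop_atTop.2 fun b => ⟨b * b, fun a ha => ?_⟩
  exact Nat.le_sqrt.2 ha

lemma growth_pos (t : ℕ) : 0 < growth t := by unfold growth; positivity

lemma growth_mono : Monotone growth := by
  intro a b h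
  unfold growth
  calc (a + 3) ^ (2 * a + 7) ≤ (b + 3) ^ (2 * a + 7) := by gcongr
    _ ≤ (b + 3) ^ (2 * b + 7) := by apply Nat.pow_le_pow_right <;> omega

lemma mult_pos (s : ℕ) : 0 < mult s := by unfold mult; exact pow_pos (growth_pos _) _

lemma two_le_base (s : ℕ) : 2 ≤ base s := by unfold base; omega

lemma runs_pos (s : ℕ) : 0 < runs s := by
  unfold runs
  have := two_le_base s
  exact Nat.mul_pos (mult_pos s) (by positivity)

lemma gap_pos (s : ℕ) : 0 < gap s := Nat.factorial_pos _

lemma lt_gap (s d : ℕ) (h : d ≤ s) : len s + d + 1 < gap s := by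
  have h1 := len_le s
  have : (s + 3) * ((s + 2) * (s + 1).factorial) = gap s := by
    unfold gap; rw [Nat.factorial_succ (s + 2), Nat.factorial_succ (s + 1)]
  have h3 := Nat.factorial_pos (s + 1)
  nlinarith [Nat.mul_le_mul_left ((s + 3) * (s + 2)) h3]

lemma start_succ_ge (s : ℕ) : start s + runs s * gap s ≤ start (s + 1) :=
  Nat.le_mul_of_pos_right _ (Nat.factorial_pos _)

lemma start_lt_succ (s : ℕ) : start s < start (s + 1) :=
  lt_of_lt_of_le (Nat.lt_add_of_pos_right (Nat.mul_pos (runs_pos s) (gap_pos s)))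
    (start_succ_ge s)

lemma start_strictMono : StrictMono start := strictMono_nat_of_lt_succ start_lt_succ

lemma le_start (s : ℕ) : s ≤ start s := start_strictMono.le_apply

lemma dvd_start {m s : ℕ} (hm : 0 < m) (h : m ≤ s) : m ∣ start s := by
  cases s with
  | zero => omega
  | succ s => exact Dvd.dvd.mul_left (Nat.dvd_factorial hm h) _

lemma dvd_gap {m s : ℕ} (hm : 0 < m) (h : m ≤ s) : m ∣ gap s :=
  Nat.dvd_factorial hm (by omega)

lemma idx_spec (i : ℕ) : start (idx i) ≤ i ∧ i < start (idx i + 1) := by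
  induction i with
  | zero => exact ⟨le_rfl, start_lt_succ 0⟩
  | succ i ih =>
    rw [idx]
    split_ifs with h
    · exact ⟨h, by have := start_lt_succ (idx i + 1); omega⟩
    · exact ⟨by omega, by omega⟩

lemma idx_eq {i s : ℕ} (h1 : start s ≤ i) (h2 : i < start (s + 1)) : idx i = s := by
  have h := idx_spec i
  have a := start_strictMono.lt_iff_lt.1 (lt_of_le_of_lt h.1 h2)
  have b := start_strictMono.lt_iff_lt.1 (lt_of_le_of_lt h1 h.2)
  omega

lemma idx_mono : Monotone idx := by
  intro i j h
  have a := start_strictMono.lt_iff_lt.1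
    (lt_of_le_of_lt ((idx_spec i).1.trans h) (idx_spec j).2)
  omega

lemma le_idx_iff {i s : ℕ} : s ≤ idx i ↔ start s ≤ i := by
  constructor
  · intro h; exact (start_strictMono.monotone h).trans (idx_spec i).1
  · intro h
    have := start_strictMono.lt_iff_lt.1 (lt_of_le_of_lt h (idx_spec i).2)
    omega

lemma idx_le (i : ℕ) : idx i ≤ i := (le_start _).trans (idx_spec i).1

lemma tendsto_idx : Tendsto idx atTop atTop :=
  tendsto_atTop_atTop.2 fun b => ⟨start b, fun _ ha => le_idx_iff.2 ha⟩

lemma coords (i : ℕ) : start (idx i) + cell i * gap (idx i) + off i = i := by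
  have := Nat.div_add_mod (i - start (idx i)) (gap (idx i))
  have h := (idx_spec i).1
  unfold cell off
  rw [mul_comm] at this
  omega

lemma coord_lt {s u o : ℕ} (hu : u < runs s) (ho : o < gap s) :
    start s + u * gap s + o < start (s + 1) := by
  have h := start_succ_ge s
  have : (u + 1) * gap s ≤ runs s * gap s := Nat.mul_le_mul_right _ hu
  nlinarith

lemma idx_coord {s u o : ℕ} (hu : u < runs s) (ho : o < gap s) :
    idx (start s + u * gap s + o) = s :=
  idx_eq (by omega) (coord_lt hu ho)

lemma cell_coord {s u o : ℕ} (hu : u < runs s) (ho : o < gap s) :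
    cell (start s + u * gap s + o) = u := by
  unfold cell
  rw [idx_coord hu ho]
  have : start s + u * gap s + o - start s = o + u * gap s := by omega
  rw [this, Nat.add_mul_div_right _ _ (gap_pos s), Nat.div_eq_of_lt ho, zero_add]

lemma off_coord {s u o : ℕ} (hu : u < runs s) (ho : o < gap s) :
    off (start s + u * gap s + o) = o := by
  unfold off
  rw [idx_coord hu ho]
  have : start s + u * gap s + o - start s = o + u * gap s := by omega
  rw [this, Nat.add_mul_mod_self_right, Nat.mod_eq_of_lt ho]

/-- Moving by `e` inside a cell changes only the offset. -/
lemma coords_add {i e : ℕ} (hc : cell i < runs (idx i)) (he : off i + e < gap (idx i)) :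
    idx (i + e) = idx i ∧ cell (i + e) = cell i ∧ off (i + e) = off i + e := by
  have h := coords i
  have h2 : i + e = start (idx i) + cell i * gap (idx i) + (off i + e) := by omega
  rw [h2]
  exact ⟨idx_coord hc he, cell_coord hc he, off_coord hc he⟩

lemma off_mod {i m : ℕ} (hm : 0 < m) (h : m ≤ idx i) : off i % m = i % m := by
  conv_rhs => rw [← coords i]
  rw [Nat.add_mod, Nat.mod_eq_zero_of_dvd
    (dvd_add (dvd_start hm h) (Dvd.dvd.mul_left (dvd_gap hm h) _)), zero_add, Nat.mod_mod]

/-- Upper bound for the discrepancy of all sweeps up to `s`. -/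
def errSum (s : ℕ) : ℕ := ∑ v ∈ range (s + 1), (len v + 1) * base v ^ len v

/-- The total number of positions used by words longer than `L` in the sweeps up to `s`. -/
def longSum (L s : ℕ) : ℕ :=
  ∑ v ∈ range (s + 1), if L < len v then (len v + 1) * runs v else 0

lemma le_errSum (s : ℕ) : s + 1 ≤ errSum s := by
  unfold errSum
  calc s + 1 = ∑ v ∈ range (s + 1), 1 := by simp
    _ ≤ _ := by
      apply Finset.sum_le_sum
      intro v _
      have := two_le_base v
      have : 0 < base v ^ len v := by positivity
      nlinarith

/-- Before any large position there is a complete sweep of words of length `L` which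
outweighs both the accumulated discrepancies and all longer words. -/
lemma exists_anchor (L D : ℕ) (hL : 1 ≤ L) : ∃ s₀, ∀ s ≥ s₀, ∃ a < s, len a = L ∧
    D * errSum s ≤ mult a ∧ D * longSum L s ≤ mult a := by
  refine ⟨(L + D + 3) * (L + D + 3), fun s hs => ?_⟩
  have ht : L + D + 3 ≤ stage s := Nat.le_sqrt.2 hs
  have hs1 := lt_succ_stage_sq s
  have hs2 := stage_sq_le s
  obtain ⟨T, hT, hTl, hTa, hTs⟩ : ∃ T, stage s ≤ T + 1 ∧ T ≤ stage s ∧ T * T + L < s ∧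
      ∀ v ≤ s, L < len v → stage v ≤ T := by
    by_cases h : stage s * stage s + L < s
    · exact ⟨stage s, by omega, le_rfl, h, fun v hv _ => stage_mono hv⟩
    · refine ⟨stage s - 1, by omega, by omega, ?_, ?_⟩
      · obtain ⟨w, hw⟩ : ∃ w, stage s = w + 1 := ⟨stage s - 1, by omega⟩
        rw [hw] at hs2 ht ⊢
        simp only [Nat.add_sub_cancel]
        nlinarith
      · intro v hv hlv
        have h1 := stage_mono hv
        by_contra hcon
        have h2 : stage v = stage s := by omega
        unfold len at hlv
        rw [h2] at hlv
        omega
  have hDT : D ≤ T := by omega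
  have hLT : L ≤ 2 * T := by omega
  refine ⟨T * T + L, hTa, len_eq hLT, ?_, ?_⟩
  · have hm : growth T ≤ mult (T * T + L) := by
      unfold mult
      rw [stage_eq hLT, len_eq hLT]
      exact Nat.le_self_pow (by omega) _
    refine le_trans ?_ hm
    have h1 : errSum s ≤ (s + 1) * ((2 * T + 3) * (T + 3) ^ (2 * T + 2)) := by
      unfold errSum
      calc _ ≤ ∑ v ∈ range (s + 1), (2 * T + 3) * (T + 3) ^ (2 * T + 2) := by
            apply Finset.sum_le_sum
            intro v hv
            have hv' : v ≤ s := by simpa [Nat.lt_succ_iff] using hv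
            have h3 := stage_mono hv'
            have h4 := len_le_two_stage v
            have h5 : base v ≤ T + 3 := by unfold base; omega
            apply Nat.mul_le_mul (by omega)
            calc base v ^ len v ≤ (T + 3) ^ len v := by gcongr
              _ ≤ _ := by apply Nat.pow_le_pow_right <;> omega
        _ = _ := by simp
    have h2 : s + 1 ≤ (T + 3) ^ 2 := by nlinarith
    calc D * errSum s ≤ (T + 3) * (((T + 3) ^ 2) * ((T + 3) ^ 2 * (T + 3) ^ (2 * T + 2))) := by
          apply Nat.mul_le_mul (by omega)
          refine h1.trans ?_
          apply Nat.mul_le_mul h2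
          apply Nat.mul_le_mul_right
          nlinarith
      _ = growth T := by unfold growth; ring
  · have h1 : longSum L s ≤
        (s + 1) * ((2 * T + 1) * (growth T ^ (2 * T - L) * (T + 2) ^ (2 * T))) := by
      unfold longSum
      calc _ ≤ ∑ v ∈ range (s + 1),
            (2 * T + 1) * (growth T ^ (2 * T - L) * (T + 2) ^ (2 * T)) := by
            apply Finset.sum_le_sum
            intro v hv
            have hv' : v ≤ s := by simpa [Nat.lt_succ_iff] using hv
            split_ifs with hlv
            · have h3 := hTs v hv' hlv
              have h4 := len_le_two_stage v
              have h5 : base v ≤ T + 2 := by unfold base; omega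
              apply Nat.mul_le_mul (by omega)
              unfold runs mult
              apply Nat.mul_le_mul
              · calc growth (stage v) ^ (2 * stage v + 1 - len v)
                    ≤ growth T ^ (2 * stage v + 1 - len v) :=
                      Nat.pow_le_pow_left (growth_mono h3) _
                  _ ≤ _ := Nat.pow_le_pow_right (growth_pos T) (by omega)
              · calc base v ^ len v ≤ (T + 2) ^ len v := by gcongr
                  _ ≤ _ := by apply Nat.pow_le_pow_right <;> omega
            · exact Nat.zero_le _
        _ = _ := by simp
    have h2 : s + 1 ≤ (T + 3) ^ 2 := by nlinarith
    have h3 : mult (T * T + L) = growth T * growth T ^ (2 * T - L) := by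
      unfold mult
      rw [stage_eq hLT, len_eq hLT, ← pow_succ']
      congr 1
      omega
    have h4 : (T + 3) * ((T + 3) ^ 2 * ((T + 3) ^ 2 * (T + 3) ^ (2 * T))) ≤ growth T := by
      unfold growth
      rw [← pow_add, ← pow_add, ← pow_succ']
      apply Nat.pow_le_pow_right <;> omega
    rw [h3]
    calc D * longSum L s
        ≤ (T + 3) * ((T + 3) ^ 2 * ((T + 3) ^ 2 *
            (growth T ^ (2 * T - L) * (T + 3) ^ (2 * T)))) := by
          apply Nat.mul_le_mul (by omega)
          refine h1.trans ?_
          apply Nat.mul_le_mul h2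
          apply Nat.mul_le_mul (by nlinarith)
          apply Nat.mul_le_mul_left
          apply Nat.pow_le_pow_left
          omega
      _ = ((T + 3) * ((T + 3) ^ 2 * ((T + 3) ^ 2 * (T + 3) ^ (2 * T)))) *
            growth T ^ (2 * T - L) := by ring
      _ ≤ _ := Nat.mul_le_mul_right _ h4

/-- Words of length `l` over `b` letters with `k` prescribed letters make up a proportion
`b ^ (-k)` of all words. -/
lemma card_words {b l k : ℕ} (φ : Fin k → Fin l) (hφ : Function.Injective φ) (B : Fin k → Fin b) :
    (univ.filter fun w : Fin l → Fin b => ∀ j, w (φ j) = B j).card * b ^ k = b ^ l := by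
  let t : Fin l → Finset (Fin b) := fun p => if h : ∃ j, φ j = p then {B h.choose} else univ
  have h1 : (univ.filter fun w : Fin l → Fin b => ∀ j, w (φ j) = B j) = Fintype.piFinset t := by
    ext w
    simp only [mem_filter, mem_univ, true_and, Fintype.mem_piFinset, t]
    constructor
    · intro h p
      split_ifs with hp
      · rw [mem_singleton, ← h hp.choose, hp.choose_spec]
      · exact mem_univ _
    · intro h j
      have h2 := h (φ j)
      have hp : ∃ j', φ j' = φ j := ⟨j, rfl⟩
      rw [dif_pos hp, mem_singleton] at h2
      rw [h2, hφ hp.choose_spec]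
  have h2 : ∀ p, (t p).card = if p ∈ univ.image φ then 1 else b := by
    intro p
    simp only [t, mem_image, mem_univ, true_and]
    split_ifs <;> simp
  have h3 : (univ.image φ).card = k := by rw [card_image_of_injective _ hφ]; simp
  rw [h1, Fintype.card_piFinset]
  simp_rw [h2]
  rw [prod_ite, prod_const_one, one_mul, prod_const]
  have h4 : (univ.filter fun p => p ∉ univ.image φ).card + k = l := by
    have := card_filter_add_card_filter_not (s := (univ : Finset (Fin l)))
      (fun p => p ∈ univ.image φ)
    rw [filter_mem_eq_inter, univ_inter, h3] at this
    simp only [card_univ, Fintype.card_fin] at this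
    omega
  rw [← pow_add, h4]

lemma card_digit_pattern {b l k o d : ℕ} {B : Fin k → ℕ} (hB : ∀ j, B j < b) (hd : 0 < d)
    (ho : ∀ j : Fin k, o + (j : ℕ) * d < l) :
    Nat.count (fun u => ∀ j : Fin k, u / b ^ (o + (j : ℕ) * d) % b = B j) (b ^ l) * b ^ k
      = b ^ l := by
  have hinj : Function.Injective fun j : Fin k => (⟨o + (j : ℕ) * d, ho j⟩ : Fin l) := by
    intro i j h
    have h1 : o + (i : ℕ) * d = o + (j : ℕ) * d := by simpa using h
    exact Fin.ext (Nat.eq_of_mul_eq_mul_right hd (by omega))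
  have hw := card_words _ hinj (fun j => (⟨B j, hB j⟩ : Fin b))
  refine Eq.trans ?_ hw
  · congr 1
    rw [Nat.count_eq_card_filter_range]
    symm
    apply Finset.card_bij (fun w _ => (finFunctionFinEquiv w : ℕ))
    · intro w hw
      simp only [mem_filter, mem_univ, true_and, mem_range] at hw ⊢
      refine ⟨Fin.is_lt _, fun j => ?_⟩
      have := finFunctionFinEquiv_symm_apply_val (finFunctionFinEquiv w) ⟨o + (j : ℕ) * d, ho j⟩
      rw [Equiv.symm_apply_apply] at this
      rw [← this, hw j]
    · intro w _ w' _ h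
      exact finFunctionFinEquiv.injective (Fin.ext h)
    · intro u hu
      simp only [mem_filter, mem_univ, true_and, mem_range] at hu ⊢
      refine ⟨finFunctionFinEquiv.symm ⟨u, hu.1⟩, fun j => ?_, by simp⟩
      apply Fin.ext
      rw [finFunctionFinEquiv_symm_apply_val]
      exact hu.2 j

lemma pow_div_add_mod {b l p : ℕ} (hb : 0 < b) (hp : p < l) (c u : ℕ) :
    (c * b ^ l + u) / b ^ p % b = u / b ^ p % b := by
  obtain ⟨e, rfl⟩ : ∃ e, l = p + (e + 1) := ⟨l - p - 1, by omega⟩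
  have : c * b ^ (p + (e + 1)) + u = u + b ^ p * (b * (c * b ^ e)) := by ring
  rw [this, Nat.add_mul_div_left _ _ (by positivity), Nat.add_mul_mod_self_left]

lemma abs_card_digit_pattern_sub {b l k o d : ℕ} {B : Fin k → ℕ} (hB : ∀ j, B j < b)
    (hb : 0 < b) (hd : 0 < d) (ho : ∀ j : Fin k, o + (j : ℕ) * d < l) (ν : ℕ) :
    |(((range ν).filter fun u => ∀ j : Fin k, u / b ^ (o + (j : ℕ) * d) % b = B j).card : ℝ)
      - ν / (b : ℝ) ^ k| ≤ (b : ℝ) ^ l := by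
  set p : ℕ → Prop := fun u => ∀ j : Fin k, u / b ^ (o + (j : ℕ) * d) % b = B j with hp
  have hper : ∀ c u, p (c * b ^ l + u) ↔ p u := by
    intro c u
    simp only [hp]
    refine forall_congr' fun j => ?_
    rw [pow_div_add_mod hb (ho j)]
  have hcount := card_digit_pattern hB hd ho
  change Nat.count p (b ^ l) * b ^ k = b ^ l at hcount
  have hmul : ∀ c, Nat.count p (c * b ^ l) = c * Nat.count p (b ^ l) := by
    intro c
    induction c with
    | zero => simp
    | succ c ih =>
      rw [add_mul, one_mul, Nat.count_add, ih, add_mul, one_mul]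
      congr 2
      ext u
      exact hper c u
  rw [← Nat.count_eq_card_filter_range p ν]
  set P := Nat.count p (b ^ l) with hP
  have hbl : 0 < b ^ l := by positivity
  have h1 := Nat.div_add_mod ν (b ^ l)
  have h2 := Nat.mod_lt ν hbl
  generalize ν / b ^ l = c at h1
  generalize ν % b ^ l = ρ at h1 h2
  have lo : c * P ≤ Nat.count p ν := by
    rw [← hmul]; apply Nat.count_monotone; rw [mul_comm]; omega
  have hi : Nat.count p ν ≤ (c + 1) * P := by
    rw [← hmul]; apply Nat.count_monotone; rw [add_mul, mul_comm c]; omega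
  have hbk : (0 : ℝ) < (b : ℝ) ^ k := by positivity
  have hPr : (P : ℝ) * (b : ℝ) ^ k = (b : ℝ) ^ l := by exact_mod_cast hcount
  have hPle : (P : ℝ) ≤ (b : ℝ) ^ l := by
    rw [← hPr]
    have : (1 : ℝ) ≤ (b : ℝ) ^ k := one_le_pow₀ (by exact_mod_cast hb)
    nlinarith [Nat.cast_nonneg (α := ℝ) P]
  have lo' : (c : ℝ) * P ≤ Nat.count p ν := by exact_mod_cast lo
  have hi' : (Nat.count p ν : ℝ) ≤ (c + 1) * P := by exact_mod_cast hi
  have e1 : (c : ℝ) * P ≤ ν / (b : ℝ) ^ k := by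
    rw [le_div_iff₀ hbk, mul_assoc, hPr]
    have : c * b ^ l ≤ ν := by rw [mul_comm]; omega
    exact_mod_cast this
  have e2 : ν / (b : ℝ) ^ k ≤ (c + 1) * P := by
    rw [div_le_iff₀ hbk, mul_assoc, hPr]
    have : ν ≤ (c + 1) * b ^ l := by rw [add_mul, mul_comm c]; omega
    exact_mod_cast this
  rw [abs_le]
  constructor <;> linarith

/-- The number of cells of sweep `s` whose position at offset `o` precedes `n`. -/
def reach (s o n : ℕ) : ℕ := min (runs s) ((n - (start s + o) + (gap s - 1)) / gap s)

lemma lt_reach {s o n u : ℕ} : u < reach s o n ↔ u < runs s ∧ start s + u * gap s + o < n := by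
  unfold reach
  rw [lt_min_iff]
  refine and_congr_right fun _ => ?_
  have hg := gap_pos s
  rw [← Nat.succ_le_iff, Nat.le_div_iff_mul_le hg, Nat.succ_mul]
  omega

lemma reach_le (s o n : ℕ) : reach s o n ≤ runs s := min_le_left _ _

lemma reach_eq {s o n : ℕ} (h : s < idx n) (ho : o < gap s) : reach s o n = runs s := by
  refine le_antisymm (reach_le _ _ _) ?_
  by_contra hc
  push Not at hc
  have := lt_reach.2 ⟨hc, lt_of_lt_of_le (coord_lt hc ho) (le_idx_iff.1 h)⟩
  omega

lemma reach_anti {s o o' n : ℕ} (h : o ≤ o') : reach s o' n ≤ reach s o n := by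
  unfold reach
  apply min_le_min_left
  apply Nat.div_le_div_right
  omega

lemma reach_succ_le {s o o' n : ℕ} (ho' : o' < gap s) : reach s o n ≤ reach s o' n + 1 := by
  by_contra hc
  push Not at hc
  have h1 := lt_reach.1 hc
  have h2 : ¬ reach s o' n < reach s o' n := lt_irrefl _
  rw [lt_reach] at h2
  have h3 : (reach s o' n + 1) * gap s = reach s o' n * gap s + gap s := by ring
  apply h2
  constructor
  · omega
  · omega

/-- Sums over positions inside words, organised by sweep, offset and cell. -/
lemma coord_sum (f : ℕ → ℕ → ℕ → ℝ) (n : ℕ) :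
    (∑ i ∈ range n, if cell i < runs (idx i) ∧ off i ≤ len (idx i) then
      f (idx i) (off i) (cell i) else 0) =
    ∑ s ∈ range (idx n + 1), ∑ o ∈ range (len s + 1), ∑ u ∈ range (reach s o n), f s o u := by
  rw [← sum_filter, sum_sigma', sum_sigma']
  have hlen : ∀ s, len s < gap s := fun s => by have := lt_gap s 0 (Nat.zero_le _); omega
  refine Finset.sum_nbij' (fun i => ⟨⟨idx i, off i⟩, cell i⟩)
    (fun x => start x.1.1 + x.2 * gap x.1.1 + x.1.2) ?_ ?_ ?_ ?_ ?_
  · intro i hi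
    simp only [mem_filter, mem_range, mem_sigma] at hi ⊢
    have h1 := idx_mono hi.1.le
    refine ⟨⟨by omega, by omega⟩, lt_reach.2 ⟨hi.2.1, ?_⟩⟩
    rw [coords]; exact hi.1
  · rintro ⟨⟨s, o⟩, u⟩ hx
    simp only [mem_filter, mem_range, mem_sigma] at hx ⊢
    obtain ⟨⟨hs, ho⟩, hu⟩ := hx
    have h2 := lt_reach.1 hu
    have ho' : o < gap s := by have := hlen s; omega
    rw [idx_coord h2.1 ho', cell_coord h2.1 ho', off_coord h2.1 ho']
    exact ⟨h2.2, h2.1, by omega⟩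
  · intro i _
    exact coords i
  · rintro ⟨⟨s, o⟩, u⟩ hx
    simp only [mem_range, mem_sigma] at hx ⊢
    obtain ⟨⟨hs, ho⟩, hu⟩ := hx
    have h2 := lt_reach.1 hu
    have ho' : o < gap s := by have := hlen s; omega
    rw [idx_coord h2.1 ho', cell_coord h2.1 ho', off_coord h2.1 ho']
  · intro i _
    rfl

lemma digit_lt_base_iff {i : ℕ} :
    digit i < base (idx i) ↔ cell i < runs (idx i) ∧ off i < len (idx i) := by
  unfold digit
  split_ifs with h
  · exact iff_of_true (Nat.mod_lt _ (by have := two_le_base (idx i); omega)) h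
  · exact iff_of_false (lt_irrefl _) h

/-- An arithmetic pattern of small digits lies inside a single word. -/
lemma digit_window {i d k : ℕ} {B : Fin k → ℕ} (hk : 0 < k) (hdi : d ≤ idx i)
    (hB : ∀ j, B j < base (idx i)) :
    (∀ j : Fin k, digit (i + (j : ℕ) * d) = B j) ↔
      cell i < runs (idx i) ∧ off i + (k - 1) * d < len (idx i) ∧
      ∀ j : Fin k, cell i / base (idx i) ^ (off i + (j : ℕ) * d) % base (idx i) = B j := by
  have hg := lt_gap (idx i) d hdi
  have eval : ∀ e, cell i < runs (idx i) → off i + e < len (idx i) →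
      digit (i + e) = cell i / base (idx i) ^ (off i + e) % base (idx i) := by
    intro e hc he
    obtain ⟨h1, h2, h3⟩ := coords_add hc (show off i + e < gap (idx i) by omega)
    unfold digit
    rw [h1, h2, h3, if_pos ⟨hc, he⟩]
  constructor
  · intro h
    have hc : cell i < runs (idx i) ∧ off i < len (idx i) := by
      apply digit_lt_base_iff.1
      have := h ⟨0, hk⟩
      simp only [zero_mul, add_zero] at this
      rw [this]; exact hB _
    have hw : ∀ j, j < k → off i + j * d < len (idx i) := by
      intro j
      induction j with
      | zero => intro _; simpa using hc.2
      | succ j ih =>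
        intro hj
        have h1 := ih (by omega)
        have h0 : (j + 1) * d = j * d + d := by ring
        obtain ⟨h2, h3, h4⟩ := coords_add hc.1
          (show off i + (j + 1) * d < gap (idx i) by omega)
        have h5 := h ⟨j + 1, hj⟩
        have h6 : digit (i + (j + 1) * d) < base (idx (i + (j + 1) * d)) := by
          rw [h2]; simp only at h5; rw [h5]; exact hB _
        have h7 := (digit_lt_base_iff.1 h6).2
        rwa [h2, h4] at h7
    refine ⟨hc.1, hw (k - 1) (by omega), fun j => ?_⟩
    rw [← eval _ hc.1 (hw j j.2), h j]
  · rintro ⟨hc, hw, h⟩ j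
    rw [eval _ hc, h j]
    have : (j : ℕ) * d ≤ (k - 1) * d := Nat.mul_le_mul_right _ (by have := j.2; omega)
    omega

/-- The number of occurrences of `B` along steps of size `d`, starting at positions `i < n` with
`i ≡ r (mod m)`. -/
def cnt (m r d k : ℕ) (B : Fin k → ℕ) (n : ℕ) : ℕ :=
  ((range n).filter fun i => i % m = r ∧ ∀ j : Fin k, digit (i + (j : ℕ) * d) = B j).card

/-- The main term of `cnt`, which does not depend on the block. -/
noncomputable def winMain (m r d k n : ℕ) : ℝ :=
  ∑ s ∈ range (idx n + 1), ∑ o ∈ range (len s + 1),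
    if o % m = r ∧ o + (k - 1) * d < len s then (reach s o n : ℝ) / (base s : ℝ) ^ k else 0

lemma abs_sum_sub_sum_le {a b : ℕ → ℝ} {K : ℕ} (h : ∀ i, K ≤ i → a i = b i)
    (h1 : ∀ i, |a i - b i| ≤ 1) (n : ℕ) :
    |∑ i ∈ range n, a i - ∑ i ∈ range n, b i| ≤ K := by
  rw [← sum_sub_distrib]
  refine (abs_sum_le_sum_abs _ _).trans ?_
  calc ∑ i ∈ range n, |a i - b i| ≤ ∑ i ∈ range n, if i < K then (1 : ℝ) else 0 := by
        apply sum_le_sum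
        intro i _
        split_ifs with hi
        · exact h1 i
        · rw [h i (by omega), sub_self, abs_zero]
    _ ≤ ∑ i ∈ range K, (1 : ℝ) := by
        rw [← sum_filter]
        apply sum_le_sum_of_subset_of_nonneg
        · intro i hi
          simp only [mem_filter] at hi
          exact mem_range.2 hi.2
        · intros; norm_num
    _ = K := by simp

lemma abs_cnt_sub_winMain_le {m r d k : ℕ} (hm : 0 < m) (hd : 0 < d) (hk : 0 < k)
    (B : Fin k → ℕ) :
    ∃ K : ℕ, ∀ n, |(cnt m r d k B n : ℝ) - winMain m r d k n| ≤ K + errSum (idx n) := by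
  obtain ⟨β, hβ⟩ : ∃ β, ∀ j, B j ≤ β :=
    ⟨univ.sup B, fun j => Finset.le_sup (f := B) (mem_univ j)⟩
  obtain ⟨s₀, hs₀⟩ : ∃ s₀, ∀ s ≥ s₀, m ≤ s ∧ d ≤ s ∧ β < base s := by
    obtain ⟨s₁, h⟩ := (tendsto_atTop_atTop.1 tendsto_stage) β
    refine ⟨max s₁ (max m d), fun s hs => ⟨?_, ?_, ?_⟩⟩
    · omega
    · omega
    · have := h s (by omega)
      unfold base; omega
  refine ⟨start s₀, fun n => ?_⟩
  let pat : ℕ → ℕ → ℕ → Prop := fun s o u =>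
    ∀ j : Fin k, u / base s ^ (o + (j : ℕ) * d) % base s = B j
  let f : ℕ → ℕ → ℕ → ℝ := fun s o u =>
    if o % m = r ∧ o + (k - 1) * d < len s then
      (if s₀ ≤ s then (if pat s o u then 1 else 0) else 1 / (base s : ℝ) ^ k) else 0
  have hbpos : ∀ s, (0 : ℝ) < (base s : ℝ) ^ k := fun s => by
    have := two_le_base s
    have : (0 : ℝ) < base s := by exact_mod_cast (by omega : 0 < base s)
    positivity
  have hf01 : ∀ s o u, 0 ≤ f s o u ∧ f s o u ≤ 1 := by
    intro s o u
    have h1 : (1 : ℝ) ≤ (base s : ℝ) ^ k :=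
      one_le_pow₀ (by exact_mod_cast (by have := two_le_base s; omega : 1 ≤ base s))
    have h2 : 1 / (base s : ℝ) ^ k ≤ 1 := by rw [div_le_one (hbpos s)]; exact h1
    have h3 : 0 ≤ 1 / (base s : ℝ) ^ k := by have := hbpos s; positivity
    simp only [f]
    split_ifs <;> first | exact ⟨h3, h2⟩ | norm_num
  have hcnt : (cnt m r d k B n : ℝ) = ∑ i ∈ range n,
      if i % m = r ∧ ∀ j : Fin k, digit (i + (j : ℕ) * d) = B j then (1 : ℝ) else 0 := by
    unfold cnt
    rw [card_filter]
    push_cast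
    rfl
  have hA : |(cnt m r d k B n : ℝ) - ∑ i ∈ range n,
      (if cell i < runs (idx i) ∧ off i ≤ len (idx i) then
        f (idx i) (off i) (cell i) else 0)| ≤ start s₀ := by
    rw [hcnt]
    apply abs_sum_sub_sum_le
    · intro i hi
      have hs := hs₀ (idx i) (le_idx_iff.2 hi)
      have hw := digit_window (i := i) (B := B) hk hs.2.1
        (fun j => lt_of_le_of_lt (hβ j) hs.2.2)
      have hmod := off_mod hm hs.1
      simp only [f, pat, hw, hmod, if_pos (le_idx_iff.2 hi)]
      by_cases h1 : cell i < runs (idx i) <;> by_cases h2 : i % m = r <;>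
        by_cases h3 : off i + (k - 1) * d < len (idx i) <;>
        (simp [h1, h2, h3]; try (intros; omega))
    · intro i
      have := hf01 (idx i) (off i) (cell i)
      rw [abs_le]
      split_ifs <;> constructor <;> linarith
  have hB : |(∑ s ∈ range (idx n + 1), ∑ o ∈ range (len s + 1), ∑ u ∈ range (reach s o n),
      f s o u) - winMain m r d k n| ≤ errSum (idx n) := by
    unfold winMain errSum
    rw [← sum_sub_distrib]
    push_cast
    refine (abs_sum_le_sum_abs _ _).trans (sum_le_sum fun s _ => ?_)
    rw [← sum_sub_distrib]
    refine (abs_sum_le_sum_abs _ _).trans ?_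
    calc _ ≤ ∑ o ∈ range (len s + 1), (base s : ℝ) ^ len s := by
          apply sum_le_sum
          intro o _
          have hp : (0 : ℝ) ≤ (base s : ℝ) ^ len s := by positivity
          by_cases hc : o % m = r ∧ o + (k - 1) * d < len s
          · simp only [f, if_pos hc]
            by_cases hs : s₀ ≤ s
            · simp only [if_pos hs]
              rw [← sum_filter, sum_const, nsmul_eq_mul, mul_one]
              apply abs_card_digit_pattern_sub
                (fun j => lt_of_le_of_lt (hβ j) (hs₀ s hs).2.2)
                (by have := two_le_base s; omega) hd
              intro j
              have : (j : ℕ) * d ≤ (k - 1) * d :=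
                Nat.mul_le_mul_right _ (by have := j.2; omega)
              omega
            · simp only [if_neg hs, sum_const, card_range, nsmul_eq_mul]
              rw [mul_one_div, sub_self, abs_zero]
              exact hp
          · simp only [f, if_neg hc, sum_const_zero, sub_zero, abs_zero]
            exact hp
      _ = _ := by simp
  rw [coord_sum] at hA
  rw [abs_le] at hA hB ⊢
  constructor <;> linarith

open Asymptotics

/-- A quantity dominated by the accumulated discrepancies and the words longer than `L` is
negligible against one which dominates every complete sweep of words of length `L`. -/
lemma isLittleO_of_anchor {L : ℕ} (hL : 1 ≤ L) {w e : ℕ → ℝ} {c C : ℝ} (hc : 0 < c)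
    (hw : ∀ᶠ n in atTop, ∀ a < idx n, len a = L → c * mult a ≤ w n)
    (he : ∀ᶠ n in atTop, |e n| ≤ C * (errSum (idx n) + longSum L (idx n))) :
    e =o[atTop] w := by
  rw [isLittleO_iff]
  intro ε hε
  obtain ⟨D, hD⟩ := exists_nat_gt (2 * |C| / (ε * c))
  obtain ⟨s₀, hs₀⟩ := exists_anchor L D hL
  filter_upwards [hw, he, tendsto_idx.eventually_ge_atTop s₀] with n h1 h2 h3
  obtain ⟨a, ha, hla, hE, hM⟩ := hs₀ _ h3
  have h4 := h1 a ha hla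
  have hE' : (D : ℝ) * errSum (idx n) ≤ mult a := by exact_mod_cast hE
  have hM' : (D : ℝ) * longSum L (idx n) ≤ mult a := by exact_mod_cast hM
  have hmp : (0 : ℝ) < mult a := by exact_mod_cast mult_pos a
  rw [div_lt_iff₀ (by positivity)] at hD
  have hw0 : 0 ≤ w n := le_trans (by positivity) h4
  rw [Real.norm_eq_abs, Real.norm_eq_abs, abs_of_nonneg hw0]
  set X : ℝ := errSum (idx n) + longSum L (idx n) with hX
  have hX0 : 0 ≤ X := by positivity
  have h5 : |e n| ≤ |C| * X := h2.trans (mul_le_mul_of_nonneg_right (le_abs_self C) hX0)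
  have h6 : (D : ℝ) * X ≤ 2 * mult a := by rw [hX, mul_add]; linarith
  have h7 : 2 * |C| * X ≤ (D * (ε * c)) * X := mul_le_mul_of_nonneg_right hD.le hX0
  have h8 : (D * (ε * c)) * X ≤ 2 * (ε * c * mult a) := by
    have := mul_le_mul_of_nonneg_left h6 (by positivity : 0 ≤ ε * c)
    linarith
  have h9 : ε * (c * mult a) ≤ ε * w n := mul_le_mul_of_nonneg_left h4 hε.le
  linarith

lemma const_le_errSum {K : ℝ} (hK : 0 ≤ K) (s L : ℕ) :
    K ≤ K * (errSum s + longSum L s) := by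
  have h1 : (1 : ℝ) ≤ errSum s := by
    exact_mod_cast (le_trans (by omega) (le_errSum s) : 1 ≤ errSum s)
  have h2 : (0 : ℝ) ≤ longSum L s := by positivity
  nlinarith

lemma cast_base_pos (s : ℕ) : (0 : ℝ) < base s := by
  have := two_le_base s
  exact_mod_cast (by omega : 0 < base s)

lemma len_lt_gap (s : ℕ) : len s < gap s := by
  have := lt_gap s 0 (Nat.zero_le _)
  omega

/-- A double sum over sweeps and offsets dominates each of its terms. -/
lemma single_le_double_sum {f : ℕ → ℕ → ℝ} (hf : ∀ s o, 0 ≤ f s o) {a o n : ℕ} (ha : a < n)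
    (ho : o ≤ len a) :
    f a o ≤ ∑ s ∈ range n, ∑ o ∈ range (len s + 1), f s o :=
  (single_le_sum (f := fun o => f a o) (fun _ _ => hf _ _) (mem_range.2 (by omega))).trans
    (single_le_sum (f := fun s => ∑ o ∈ range (len s + 1), f s o)
      (fun _ _ => sum_nonneg fun _ _ => hf _ _) (mem_range.2 ha))

lemma double_sum_le_longSum {f : ℕ → ℕ → ℝ} {L s : ℕ} (h0 : ∀ v o, ¬ L < len v → o ≤ len v → f v o ≤ 0)
    (h1 : ∀ v o, f v o ≤ runs v) :
    ∑ v ∈ range (s + 1), ∑ o ∈ range (len v + 1), f v o ≤ longSum L s := by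
  unfold longSum
  push_cast
  refine sum_le_sum fun v _ => ?_
  split_ifs with h
  · refine (sum_le_card_nsmul _ _ (runs v : ℝ) fun o _ => h1 v o).trans ?_
    simp
  · exact sum_nonpos fun o ho => h0 v o h (by simpa [Nat.lt_succ_iff] using ho)

lemma reach_div_le {s o n k : ℕ} {b : ℝ} (hb : 1 ≤ b) : (reach s o n : ℝ) / b ^ k ≤ runs s :=
  (div_le_self (by positivity) (one_le_pow₀ hb)).trans (by exact_mod_cast reach_le s o n)

lemma one_le_cast_base (s : ℕ) : (1 : ℝ) ≤ base s := by
  have := two_le_base s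
  exact_mod_cast (by omega : 1 ≤ base s)

lemma le_winMain {m r d k : ℕ} (hr : r < m) (hd : 0 < d) (hk : 0 < k) {n a : ℕ}
    (ha : a < idx n) (hl : len a = r + (k - 1) * d + 1) : (mult a : ℝ) ≤ winMain m r d k n := by
  have hb := cast_base_pos a
  refine le_trans ?_ (single_le_double_sum (a := a) (o := r) ?_ (by omega) (by omega))
  · have hg := len_lt_gap a
    rw [if_pos ⟨Nat.mod_eq_of_lt hr, by omega⟩, reach_eq ha (by omega), le_div_iff₀ (by positivity)]
    unfold runs
    push_cast
    have : k ≤ len a := by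
      rw [hl]
      have : k - 1 ≤ (k - 1) * d := Nat.le_mul_of_pos_right _ hd
      omega
    exact mul_le_mul_of_nonneg_left (pow_le_pow_right₀ (one_le_cast_base a) this) (by positivity)
  · intro s o
    split_ifs
    · positivity
    · exact le_rfl

lemma winMain_le {m r d k L : ℕ} (hL : L ≤ r + (k - 1) * d) (n : ℕ) :
    winMain m r d k n ≤ longSum L (idx n) := by
  apply double_sum_le_longSum
  · intro v o hv _
    rw [if_neg]
    rintro ⟨h1, h2⟩
    have := Nat.mod_le o m
    omega
  · intro v o
    split_ifs
    · exact reach_div_le (one_le_cast_base v)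
    · positivity

lemma cnt_isEquivalent {m r d k : ℕ} (hr : r < m) (hd : 0 < d) (hk : 0 < k) (B : Fin k → ℕ) :
    (fun n => (cnt m r d k B n : ℝ)) ~[atTop] winMain m r d k := by
  obtain ⟨K, hK⟩ := abs_cnt_sub_winMain_le (m := m) (r := r) (by omega) hd hk B
  refine isLittleO_of_anchor (L := r + (k - 1) * d + 1) (c := 1) (C := K + 1) (by omega) one_pos
    (Eventually.of_forall fun n a ha hl => by rw [one_mul]; exact le_winMain hr hd hk ha hl)
    (Eventually.of_forall fun n => (hK n).trans ?_)
  have := const_le_errSum (K := K) (by positivity) (idx n) (r + (k - 1) * d + 1)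
  have h2 : (0 : ℝ) ≤ longSum (r + (k - 1) * d + 1) (idx n) := by positivity
  linarith

lemma eventually_exists_len {L : ℕ} (hL : 1 ≤ L) : ∀ᶠ n in atTop, ∃ a < idx n, len a = L := by
  obtain ⟨s₀, h⟩ := exists_anchor L 0 hL
  filter_upwards [tendsto_idx.eventually_ge_atTop s₀] with n hn
  obtain ⟨a, ha, hl, -⟩ := h _ hn
  exact ⟨a, ha, hl⟩

lemma winMain_pos {m r d k : ℕ} (hr : r < m) (hd : 0 < d) (hk : 0 < k) :
    ∀ᶠ n in atTop, 0 < winMain m r d k n := by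
  filter_upwards [eventually_exists_len (L := r + (k - 1) * d + 1) (by omega)] with n hn
  obtain ⟨a, ha, hl⟩ := hn
  exact lt_of_lt_of_le (by exact_mod_cast mult_pos a) (le_winMain hr hd hk ha hl)

lemma tendsto_cnt_div_winMain {m r d k : ℕ} (hr : r < m) (hd : 0 < d) (hk : 0 < k)
    (B : Fin k → ℕ) :
    Tendsto (fun n => (cnt m r d k B n : ℝ) / winMain m r d k n) atTop (𝓝 1) :=
  (isEquivalent_iff_tendsto_one ((winMain_pos hr hd hk).mono fun _ h => h.ne')).1
    (cnt_isEquivalent hr hd hk B)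

lemma tendsto_cnt_div_cnt {m r d k : ℕ} (hr : r < m) (hd : 0 < d) (hk : 0 < k)
    (B₁ B₂ : Fin k → ℕ) :
    Tendsto (fun n => (cnt m r d k B₁ n : ℝ) / cnt m r d k B₂ n) atTop (𝓝 1) := by
  have := (tendsto_cnt_div_winMain hr hd hk B₁).div (tendsto_cnt_div_winMain hr hd hk B₂)
    one_ne_zero
  rw [div_one] at this
  refine this.congr' ((winMain_pos hr hd hk).mono fun n h => ?_)
  simp only [Pi.div_apply]
  field_simp

/-- The reciprocal of the product of `k` consecutive terms of the basic sequence. -/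
noncomputable def wt (χ : ℕ → ℕ) (k i : ℕ) : ℝ := (∏ j ∈ range k, (bseq χ (i + j) : ℝ))⁻¹

/-- The sum of `wt` over the residue class `r` modulo `m`. -/
noncomputable def wtSum (χ : ℕ → ℕ) (m r k n : ℕ) : ℝ :=
  ∑ i ∈ range n, if i % m = r then wt χ k i else 0

/-- The main term of `wtSum`. -/
noncomputable def wtMain (χ : ℕ → ℕ) (m r k n : ℕ) : ℝ :=
  ∑ s ∈ range (idx n + 1), ∑ o ∈ range (len s + 1),
    if o % m = r ∧ 1 ≤ o ∧ o + (k - 1) ≤ len s then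
      (reach s o n : ℝ) / (((base s + 2) * (2 - χ (len s)) : ℕ) : ℝ) ^ k else 0

variable {χ : ℕ → ℕ}

lemma two_le_bseq (hχ : ∀ k, χ k ≤ 1) (i : ℕ) : base (idx i) + 2 ≤ bseq χ i := by
  unfold bseq
  split_ifs
  · have := hχ (len (idx i))
    exact Nat.le_mul_of_pos_right _ (by omega)
  · refine le_trans ?_ (Nat.self_le_factorial _)
    have h1 := idx_le i
    have h2 : stage (idx i) ≤ idx i := Nat.sqrt_le_self _
    unfold base
    omega

lemma one_le_bseq (hχ : ∀ k, χ k ≤ 1) (i : ℕ) : (1 : ℝ) ≤ bseq χ i := by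
  have := two_le_bseq hχ i
  exact_mod_cast (by omega : 1 ≤ bseq χ i)

lemma wt_pos (hχ : ∀ k, χ k ≤ 1) (k i : ℕ) : 0 < wt χ k i :=
  inv_pos.2 (prod_pos fun _ _ => lt_of_lt_of_le one_pos (one_le_bseq hχ _))

lemma wt_le_one (hχ : ∀ k, χ k ≤ 1) (k i : ℕ) : wt χ k i ≤ 1 :=
  inv_le_one_of_one_le₀ (Finset.one_le_prod fun _ _ => one_le_bseq hχ _)

lemma wt_le_of_factorial (hχ : ∀ k, χ k ≤ 1) {k i j : ℕ} (hj : j < k)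
    (h : bseq χ (i + j) = (i + j + 4).factorial) : wt χ k i ≤ 1 / ((i + 4).factorial : ℝ) := by
  rw [one_div]
  unfold wt
  have hp : (0 : ℝ) < (i + 4).factorial := by exact_mod_cast Nat.factorial_pos _
  apply inv_anti₀ hp
  calc ((i + 4).factorial : ℝ) ≤ bseq χ (i + j) := by
        rw [h]; exact_mod_cast Nat.factorial_le (by omega)
    _ ≤ _ := by
        rw [← mul_prod_erase _ _ (mem_range.2 hj)]
        exact le_mul_of_one_le_right (by positivity)
          (Finset.one_le_prod fun _ _ => one_le_bseq hχ _)

lemma wt_eq_of_run {k i : ℕ} (hc : cell i < runs (idx i))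
    (h1 : 1 ≤ off i) (h2 : off i + (k - 1) ≤ len (idx i)) :
    wt χ k i = 1 / (((base (idx i) + 2) * (2 - χ (len (idx i))) : ℕ) : ℝ) ^ k := by
  unfold wt
  rw [one_div]
  congr 1
  rw [prod_congr rfl (g := fun _ => (((base (idx i) + 2) * (2 - χ (len (idx i))) : ℕ) : ℝ)),
    prod_const, card_range]
  intro j hj
  rw [mem_range] at hj
  have hg := len_lt_gap (idx i)
  obtain ⟨e1, e2, e3⟩ := coords_add (e := j) hc (by omega)
  unfold bseq
  rw [e1, e2, e3, if_pos ⟨hc, by omega, by omega⟩]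

lemma wt_le_of_not_run (hχ : ∀ k, χ k ≤ 1) {k i : ℕ} (hk : 0 < k)
    (h : ¬ (cell i < runs (idx i) ∧ 1 ≤ off i ∧ off i + (k - 1) ≤ len (idx i))) :
    wt χ k i ≤ 1 / ((i + 4).factorial : ℝ) := by
  by_cases h0 : cell i < runs (idx i) ∧ 1 ≤ off i ∧ off i ≤ len (idx i)
  · obtain ⟨hc, h1, h2⟩ := h0
    have h3 : ¬ off i + (k - 1) ≤ len (idx i) := fun h3 => h ⟨hc, h1, h3⟩
    have hg := lt_gap (idx i) 0 (Nat.zero_le _)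
    obtain ⟨e1, e2, e3⟩ := coords_add (i := i) (e := len (idx i) + 1 - off i) hc (by omega)
    refine wt_le_of_factorial hχ (j := len (idx i) + 1 - off i) (by omega) ?_
    unfold bseq
    rw [e1, e2, e3, if_neg]
    omega
  · refine wt_le_of_factorial hχ hk ?_
    unfold bseq
    rw [add_zero, if_neg h0]

lemma sum_inv_factorial_le (n : ℕ) :
    ∑ i ∈ range n, 1 / ((i + 4).factorial : ℝ) ≤ 1 - 1 / ((n + 3).factorial : ℝ) := by
  induction n with
  | zero => norm_num [Nat.factorial]
  | succ n ih =>
    rw [sum_range_succ]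
    have h : ((n + 4).factorial : ℝ) = (n + 4) * (n + 3).factorial := by
      rw [Nat.factorial_succ]; push_cast; ring
    have hp : (0 : ℝ) < (n + 3).factorial := by exact_mod_cast Nat.factorial_pos _
    have h2 : 1 / ((n + 4).factorial : ℝ) + 1 / ((n + 4).factorial : ℝ)
        ≤ 1 / ((n + 3).factorial : ℝ) := by
      rw [h, ← add_div, div_le_div_iff₀ (by positivity) hp]
      have : (0 : ℝ) ≤ n := by positivity
      nlinarith
    have h3 : n + 1 + 3 = n + 4 := by ring
    rw [h3]
    linarith

lemma abs_wtSum_sub_wtMain_le (hχ : ∀ k, χ k ≤ 1) {m r k : ℕ} (hm : 0 < m) (hk : 0 < k) :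
    ∃ K : ℕ, ∀ n, |wtSum χ m r k n - wtMain χ m r k n| ≤ K := by
  refine ⟨start m + 1, fun n => ?_⟩
  let f : ℕ → ℕ → ℕ → ℝ := fun s o _ =>
    if o % m = r ∧ 1 ≤ o ∧ o + (k - 1) ≤ len s then
      1 / (((base s + 2) * (2 - χ (len s)) : ℕ) : ℝ) ^ k else 0
  have hmain : wtMain χ m r k n = ∑ i ∈ range n,
      if cell i < runs (idx i) ∧ off i ≤ len (idx i) then
        f (idx i) (off i) (cell i) else 0 := by
    rw [coord_sum]
    unfold wtMain
    refine sum_congr rfl fun s _ => sum_congr rfl fun o _ => ?_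
    simp only [f, sum_const, card_range, nsmul_eq_mul]
    split_ifs <;> ring
  have hf01 : ∀ s o u, 0 ≤ f s o u ∧ f s o u ≤ 1 := by
    intro s o u
    have h1 : (1 : ℝ) ≤ (((base s + 2) * (2 - χ (len s)) : ℕ) : ℝ) ^ k := by
      apply one_le_pow₀
      have := hχ (len s)
      exact_mod_cast Nat.mul_pos (by omega : 0 < base s + 2) (by omega)
    simp only [f]
    split_ifs
    · exact ⟨by positivity, by rw [div_le_one (by linarith)]; exact h1⟩
    · norm_num
  rw [hmain]
  unfold wtSum
  set g : ℕ → ℝ := fun i => if cell i < runs (idx i) ∧ off i ≤ len (idx i) then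
        f (idx i) (off i) (cell i) else 0 with hg
  set a : ℕ → ℝ := fun i => if i % m = r then wt χ k i else 0 with ha
  have hg01 : ∀ i, 0 ≤ g i ∧ g i ≤ 1 := by
    intro i
    have := hf01 (idx i) (off i) (cell i)
    simp only [hg]
    split_ifs
    · exact this
    · norm_num
  have ha01 : ∀ i, 0 ≤ a i ∧ a i ≤ 1 := by
    intro i
    simp only [ha]
    split_ifs
    · exact ⟨(wt_pos hχ _ _).le, wt_le_one hχ _ _⟩
    · norm_num
  have hclose : ∀ i, start m ≤ i → |a i - g i| ≤ 1 / ((i + 4).factorial : ℝ) := by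
    intro i hi
    have hmod := off_mod hm (le_idx_iff.2 hi)
    by_cases hrun : cell i < runs (idx i) ∧ 1 ≤ off i ∧ off i + (k - 1) ≤ len (idx i)
    · have : a i = g i := by
        simp only [ha, hg, f, hmod]
        rw [if_pos (⟨hrun.1, by omega⟩ : cell i < runs (idx i) ∧ off i ≤ len (idx i)),
          wt_eq_of_run hrun.1 hrun.2.1 hrun.2.2]
        simp [hrun.2.1, hrun.2.2]
      rw [this, sub_self, abs_zero]
      positivity
    · have hgi : g i = 0 := by
        simp only [hg, f]
        split_ifs with h1 h2
        · exact absurd ⟨h1.1, h2.2⟩ hrun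
        · rfl
        · rfl
      rw [hgi, sub_zero, abs_of_nonneg (ha01 i).1]
      simp only [ha]
      split_ifs
      · exact wt_le_of_not_run hχ hk hrun
      · positivity
  have hfac := sum_inv_factorial_le n
  have hp : (0 : ℝ) ≤ 1 / ((n + 3).factorial : ℝ) := by positivity
  rw [← sum_sub_distrib]
  refine (abs_sum_le_sum_abs _ _).trans ?_
  calc ∑ i ∈ range n, |a i - g i|
      ≤ ∑ i ∈ range n, ((if i < start m then (1 : ℝ) else 0) + 1 / ((i + 4).factorial : ℝ)) := by
        refine sum_le_sum fun i _ => ?_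
        have hq : (0 : ℝ) ≤ 1 / ((i + 4).factorial : ℝ) := by positivity
        split_ifs with h
        · have h1 := hg01 i
          have h2 := ha01 i
          have : |a i - g i| ≤ 1 := abs_le.2 ⟨by linarith, by linarith⟩
          linarith
        · rw [zero_add]; exact hclose i (by omega)
    _ ≤ start m + 1 := by
        rw [sum_add_distrib]
        have : ∑ i ∈ range n, (if i < start m then (1 : ℝ) else 0) ≤ start m := by
          rw [← sum_filter, sum_const, nsmul_eq_mul, mul_one]
          have h : (range n).filter (· < start m) ⊆ range (start m) := fun i hi => by
            simp at hi ⊢; exact hi.2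
          have := card_le_card h
          rw [card_range] at this
          exact_mod_cast this
        linarith
    _ = _ := by push_cast; rfl

lemma one_le_repetitions (hχ : ∀ k, χ k ≤ 1) (s : ℕ) :
    (1 : ℝ) ≤ (((base s + 2) * (2 - χ (len s)) : ℕ) : ℝ) := by
  have := hχ (len s)
  exact_mod_cast Nat.mul_pos (by omega : 0 < base s + 2) (by omega)

lemma le_wtMain (hχ : ∀ k, χ k ≤ 1) {m r k : ℕ} (hr : r < m) (hr1 : 1 ≤ r) {n a : ℕ}
    (ha : a < idx n) (hl : len a = r + (k - 1)) :
    (1 / 4 ^ k : ℝ) * mult a ≤ wtMain χ m r k n := by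
  have hb := cast_base_pos a
  refine le_trans ?_ (single_le_double_sum (a := a) (o := r) ?_ (by omega) (by omega))
  · have hg := len_lt_gap a
    have h1 := one_le_repetitions hχ a
    rw [if_pos ⟨Nat.mod_eq_of_lt hr, hr1, by omega⟩, reach_eq ha (by omega),
      le_div_iff₀ (by positivity)]
    have h4 : (((base a + 2) * (2 - χ (len a)) : ℕ) : ℝ) ≤ 4 * base a := by
      have h5 : (base a + 2) * (2 - χ (len a)) ≤ (base a + base a) * 2 :=
        Nat.mul_le_mul (by have := two_le_base a; omega) (by omega)
      have h6 : (base a + 2) * (2 - χ (len a)) ≤ 4 * base a := by linarith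
      exact_mod_cast h6
    calc (1 / 4 ^ k : ℝ) * mult a * (((base a + 2) * (2 - χ (len a)) : ℕ) : ℝ) ^ k
        ≤ (1 / 4 ^ k : ℝ) * mult a * (4 * base a : ℝ) ^ k :=
          mul_le_mul_of_nonneg_left (pow_le_pow_left₀ (by positivity) h4 _) (by positivity)
      _ = mult a * (base a : ℝ) ^ k := by rw [mul_pow]; field_simp
      _ ≤ runs a := by
        unfold runs
        push_cast
        exact mul_le_mul_of_nonneg_left
          (pow_le_pow_right₀ (one_le_cast_base a) (by omega)) (by positivity)
  · intro s o
    split_ifs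
    · positivity
    · exact le_rfl

lemma wtMain_zero_le (hχ : ∀ k, χ k ≤ 1) {m : ℕ} (hm : 2 ≤ m) (n : ℕ) :
    wtMain χ m 0 m n ≤ longSum m (idx n) := by
  apply double_sum_le_longSum
  · intro v o hv _
    rw [if_neg]
    rintro ⟨h1, h2, h3⟩
    have := Nat.le_of_dvd h2 (Nat.dvd_of_mod_eq_zero h1)
    omega
  · intro v o
    split_ifs
    · exact reach_div_le (one_le_repetitions hχ v)
    · positivity

lemma wtMain_nonneg (m r k n : ℕ) : 0 ≤ wtMain χ m r k n :=
  sum_nonneg fun s _ => sum_nonneg fun o _ => by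
    split_ifs
    · positivity
    · exact le_rfl

/-- In a nonzero residue class the blocks are too rare. -/
lemma cnt_isLittleO_wtSum (hχ : ∀ k, χ k ≤ 1) {m r d k : ℕ} (hr : r < m) (hr1 : 1 ≤ r)
    (hd : 0 < d) (hk : 0 < k) (B : Fin k → ℕ) :
    (fun n => (cnt m r d k B n : ℝ)) =o[atTop] wtSum χ m r k := by
  have hL : 1 ≤ r + (k - 1) := by omega
  have hw : ∀ᶠ n in atTop, ∀ a < idx n, len a = r + (k - 1) →
      (1 / 4 ^ k : ℝ) * mult a ≤ wtMain χ m r k n :=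
    Eventually.of_forall fun n a ha hl => le_wtMain hχ hr hr1 ha hl
  obtain ⟨K, hK⟩ := abs_cnt_sub_winMain_le (m := m) (r := r) (by omega) hd hk B
  obtain ⟨K', hK'⟩ := abs_wtSum_sub_wtMain_le hχ (m := m) (r := r) (by omega) hk
  have h1 : (fun n => (cnt m r d k B n : ℝ)) =o[atTop] wtMain χ m r k := by
    refine isLittleO_of_anchor (C := K + 1) hL (by positivity) hw
      (Eventually.of_forall fun n => ?_)
    have h1 := const_le_errSum (K := K) (by positivity) (idx n) (r + (k - 1))
    have h2 := (abs_le.1 (hK n)).2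
    have h3 : winMain m r d k n ≤ longSum (r + (k - 1)) (idx n) := by
      apply winMain_le
      have : k - 1 ≤ (k - 1) * d := Nat.le_mul_of_pos_right _ hd
      omega
    rw [abs_of_nonneg (by positivity)]
    linarith
  have h2 : wtSum χ m r k ~[atTop] wtMain χ m r k := by
    refine isLittleO_of_anchor (C := K') hL (by positivity) hw
      (Eventually.of_forall fun n => (hK' n).trans ?_)
    exact const_le_errSum (by positivity) _ _
  exact h1.trans_isBigO h2.isBigO_symm

/-- In the residue class of `0` the blocks are too frequent. -/
lemma wtSum_isLittleO_cnt (hχ : ∀ k, χ k ≤ 1) {m : ℕ} (hm : 2 ≤ m) (B : Fin m → ℕ) :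
    (fun n => wtSum χ m 0 m n + 1) =o[atTop] fun n => (cnt m 0 1 m B n : ℝ) := by
  obtain ⟨K', hK'⟩ := abs_wtSum_sub_wtMain_le hχ (m := m) (r := 0) (k := m) (by omega) (by omega)
  have h1 : (fun n => wtSum χ m 0 m n + 1) =o[atTop] winMain m 0 1 m := by
    refine isLittleO_of_anchor (L := m) (c := 1) (C := K' + 2) (by omega) one_pos
      (Eventually.of_forall fun n a ha hl => ?_) (Eventually.of_forall fun n => ?_)
    · rw [one_mul]
      exact le_winMain (by omega) one_pos (by omega) ha (by omega)
    · have h1 := const_le_errSum (K := K' + 1) (by positivity) (idx n) m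
      have h2 := abs_le.1 (hK' n)
      have h3 := wtMain_zero_le hχ hm n
      have h4 := wtMain_nonneg (χ := χ) m 0 m n
      have h5 : (0 : ℝ) ≤ errSum (idx n) := by positivity
      rw [abs_le]
      constructor <;> linarith
  exact h1.trans_isBigO (cnt_isEquivalent (by omega) one_pos (by omega) B).isBigO_symm

/-- The contribution of the words of length exactly `k`, with `c` added to the base. -/
noncomputable def diag (o c k n : ℕ) : ℝ :=
  ∑ s ∈ range (idx n + 1), if len s = k then (reach s o n : ℝ) / ((base s + c : ℕ) : ℝ) ^ k else 0

lemma abs_double_sum_sub_diag_le {f : ℕ → ℕ → ℝ} {o₀ k s : ℕ} (ho₀ : o₀ ≤ k)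
    (h0 : ∀ v o, 0 ≤ f v o) (h1 : ∀ v o, f v o ≤ runs v)
    (hlt : ∀ v o, len v < k → o ≤ len v → f v o = 0)
    (heq : ∀ v o, len v = k → o ≠ o₀ → o ≤ len v → f v o = 0) :
    |∑ v ∈ range (s + 1), ∑ o ∈ range (len v + 1), f v o
      - ∑ v ∈ range (s + 1), if len v = k then f v o₀ else 0| ≤ longSum k s := by
  rw [← sum_sub_distrib]
  refine (abs_sum_le_sum_abs _ _).trans ?_
  unfold longSum
  push_cast
  refine sum_le_sum fun v _ => ?_
  rcases lt_trichotomy (len v) k with h | h | h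
  · rw [if_neg h.ne, if_neg (by omega), sub_zero, sum_eq_zero, abs_zero]
    intro o ho
    exact hlt v o h (by simpa [Nat.lt_succ_iff] using ho)
  · rw [if_pos h, if_neg (by omega), sum_eq_single o₀, sub_self, abs_zero]
    · intro o ho hne
      exact heq v o h hne (by simpa [Nat.lt_succ_iff] using ho)
    · intro ho
      exact absurd (mem_range.2 (by omega)) ho
  · rw [if_neg h.ne', if_pos h, sub_zero, abs_of_nonneg (sum_nonneg fun _ _ => h0 _ _)]
    refine (sum_le_card_nsmul _ _ (runs v : ℝ) fun o _ => h1 v o).trans ?_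
    simp

lemma abs_winMain_sub_diag_le {k : ℕ} (hk : 0 < k) (n : ℕ) :
    |winMain 1 0 1 k n - diag 0 0 k n| ≤ longSum k (idx n) := by
  have := abs_double_sum_sub_diag_le (s := idx n) (o₀ := 0) (k := k) (f := fun s o =>
    if o % 1 = 0 ∧ o + (k - 1) * 1 < len s then (reach s o n : ℝ) / (base s : ℝ) ^ k else 0)
    (Nat.zero_le _) ?_ ?_ ?_ ?_
  · convert this using 3
    · rfl
    unfold diag
    refine sum_congr rfl fun s _ => ?_
    by_cases h : len s = k
    · rw [if_pos h, if_pos h, if_pos ⟨rfl, by omega⟩, add_zero]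
    · rw [if_neg h, if_neg h]
  · intro v o
    split_ifs
    · positivity
    · exact le_rfl
  · intro v o
    split_ifs
    · exact reach_div_le (one_le_cast_base v)
    · positivity
  · intro v o h _
    exact if_neg (by omega)
  · intro v o h hne _
    exact if_neg (by omega)

lemma abs_wtMain_sub_diag_le (hχ : ∀ k, χ k ≤ 1) {k : ℕ} (hk : 0 < k) (n : ℕ) :
    |wtMain χ 1 0 k n - 1 / ((2 - χ k : ℕ) : ℝ) ^ k * diag 1 2 k n| ≤ longSum k (idx n) := by
  have := abs_double_sum_sub_diag_le (s := idx n) (o₀ := 1) (k := k) (f := fun s o =>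
    if o % 1 = 0 ∧ 1 ≤ o ∧ o + (k - 1) ≤ len s then
      (reach s o n : ℝ) / (((base s + 2) * (2 - χ (len s)) : ℕ) : ℝ) ^ k else 0)
    hk ?_ ?_ ?_ ?_
  · convert this using 3
    · rfl
    unfold diag
    rw [mul_sum]
    refine sum_congr rfl fun s _ => ?_
    by_cases h : len s = k
    · rw [if_pos h, if_pos h, if_pos ⟨rfl, le_rfl, by omega⟩, h]
      rw [Nat.cast_mul, mul_pow]
      have h1 := hχ k
      have h2 : (0 : ℝ) < ((2 - χ k : ℕ) : ℝ) := by exact_mod_cast (by omega : 0 < 2 - χ k)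
      have h3 : (0 : ℝ) < ((base s + 2 : ℕ) : ℝ) := by positivity
      field_simp
    · rw [if_neg h, if_neg h, mul_zero]
  · intro v o
    split_ifs
    · positivity
    · exact le_rfl
  · intro v o
    split_ifs
    · exact reach_div_le (one_le_repetitions hχ v)
    · positivity
  · intro v o h _
    exact if_neg (by omega)
  · intro v o h hne _
    exact if_neg (by omega)

lemma le_diag {k n a : ℕ} (ha : a < idx n) (hl : len a = k) : (mult a : ℝ) ≤ diag 0 0 k n := by
  have hb := cast_base_pos a
  refine le_trans ?_ (single_le_sum (fun s _ => ?_) (mem_range.2 (by omega : a < idx n + 1)))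
  · rw [if_pos hl, reach_eq ha (gap_pos a), le_div_iff₀ (by positivity), add_zero]
    unfold runs
    push_cast
    rw [hl]
  · split_ifs
    · positivity
    · exact le_rfl

lemma diag_nonneg (o c k n : ℕ) : 0 ≤ diag o c k n :=
  sum_nonneg fun s _ => by
    split_ifs
    · positivity
    · exact le_rfl

lemma tendsto_base_ratio (k : ℕ) :
    Tendsto (fun s => ((base s : ℝ) / ((base s + 2 : ℕ) : ℝ)) ^ k) atTop (𝓝 1) := by
  have hb : Tendsto (fun s => ((base s + 2 : ℕ) : ℝ)) atTop atTop :=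
    tendsto_natCast_atTop_atTop.comp
      (tendsto_atTop_mono (fun s => by unfold base; omega) tendsto_stage)
  have h1 : Tendsto (fun s => (1 - 2 / ((base s + 2 : ℕ) : ℝ)) ^ k) atTop (𝓝 1) := by
    have := ((tendsto_const_nhds (x := (1 : ℝ))).sub
      ((tendsto_const_nhds (x := (2 : ℝ))).div_atTop hb)).pow k
    simpa using this
  refine h1.congr fun s => ?_
  have h3 : (0 : ℝ) < ((base s + 2 : ℕ) : ℝ) := by positivity
  congr 1
  rw [eq_div_iff h3.ne', sub_mul, div_mul_cancel₀ _ h3.ne']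
  push_cast
  ring

lemma diag_isEquivalent {k : ℕ} (hk : 0 < k) : diag 1 2 k ~[atTop] diag 0 0 k := by
  rw [IsEquivalent, isLittleO_iff]
  intro ε hε
  obtain ⟨s₁, hs₁⟩ := eventually_atTop.1
    ((tendsto_base_ratio k).eventually_const_lt (show 1 - ε / 2 < 1 by linarith))
  set C : ℕ := ∑ s ∈ range s₁, runs s
  have hsmall : (fun n => ((idx n + 1 + C : ℕ) : ℝ)) =o[atTop] diag 0 0 k := by
    refine isLittleO_of_anchor (L := k) (c := 1) (C := C + 1) hk one_pos
      (Eventually.of_forall fun n a ha hl => by rw [one_mul]; exact le_diag ha hl)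
      (Eventually.of_forall fun n => ?_)
    have h1 := const_le_errSum (K := C) (by positivity) (idx n) k
    have h2 : ((idx n + 1 : ℕ) : ℝ) ≤ errSum (idx n) := by exact_mod_cast le_errSum (idx n)
    have h3 : (0 : ℝ) ≤ longSum k (idx n) := by positivity
    rw [abs_of_nonneg (by positivity)]
    push_cast at h2 ⊢
    linarith
  filter_upwards [hsmall.def (half_pos hε)] with n hn
  rw [Real.norm_eq_abs, Real.norm_eq_abs, abs_of_nonneg (by positivity),
    abs_of_nonneg (diag_nonneg _ _ _ _)] at hn
  rw [Real.norm_eq_abs, Real.norm_eq_abs, abs_of_nonneg (diag_nonneg _ _ _ _), Pi.sub_apply]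
  suffices h : |diag 1 2 k n - diag 0 0 k n| ≤
      ε / 2 * diag 0 0 k n + ((idx n + 1 + C : ℕ) : ℝ) by linarith
  have hterm : ∀ s, |(if len s = k then (reach s 1 n : ℝ) / ((base s + 2 : ℕ) : ℝ) ^ k else 0)
      - (if len s = k then (reach s 0 n : ℝ) / ((base s + 0 : ℕ) : ℝ) ^ k else 0)| ≤
      ε / 2 * (if len s = k then (reach s 0 n : ℝ) / ((base s + 0 : ℕ) : ℝ) ^ k else 0)
        + 1 + if s < s₁ then (runs s : ℝ) else 0 := by
    intro s
    have hC : (0 : ℝ) ≤ if s < s₁ then (runs s : ℝ) else 0 := by split_ifs <;> positivity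
    by_cases hl : len s = k
    · simp only [if_pos hl, add_zero]
      have hg := len_lt_gap s
      have hb := cast_base_pos s
      have hb2 : (0 : ℝ) < ((base s + 2 : ℕ) : ℝ) := by positivity
      have r1 : (reach s 1 n : ℝ) ≤ reach s 0 n := by exact_mod_cast reach_anti (by omega)
      have r2 : (reach s 0 n : ℝ) ≤ reach s 1 n + 1 := by
        exact_mod_cast reach_succ_le (by omega)
      have hp1 : (1 : ℝ) ≤ (base s : ℝ) ^ k := one_le_pow₀ (one_le_cast_base s)
      have hp2 : (base s : ℝ) ^ k ≤ ((base s + 2 : ℕ) : ℝ) ^ k :=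
        pow_le_pow_left₀ hb.le (by push_cast; linarith) _
      set x : ℝ := (base s : ℝ) ^ k with hx
      set y : ℝ := ((base s + 2 : ℕ) : ℝ) ^ k with hy
      set p : ℝ := (reach s 0 n : ℝ) / x with hp
      have hp0 : 0 ≤ p := by positivity
      have u1 : (reach s 1 n : ℝ) / y ≤ p :=
        div_le_div₀ (by positivity) r1 (by linarith) hp2
      have u2 : p * (x / y) - 1 ≤ (reach s 1 n : ℝ) / y := by
        have e : p * (x / y) = reach s 0 n / y := by
          rw [hp]; field_simp
        have e2 : (reach s 0 n : ℝ) / y ≤ (reach s 1 n + 1) / y := by gcongr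
        have e3 : (1 : ℝ) / y ≤ 1 := by rw [div_le_one (by linarith)]; linarith
        rw [add_div] at e2
        linarith
      have hxy : x / y = ((base s : ℝ) / ((base s + 2 : ℕ) : ℝ)) ^ k := by
        rw [hx, hy, div_pow]
      rw [abs_of_nonpos (by linarith)]
      by_cases hs : s < s₁
      · rw [if_pos hs]
        have : p ≤ runs s := reach_div_le (one_le_cast_base s)
        have h0 : 0 ≤ (reach s 1 n : ℝ) / y := by positivity
        nlinarith
      · rw [if_neg hs]
        have h2 := hs₁ s (by omega)
        rw [← hxy] at h2
        nlinarith
    · simp only [if_neg hl, sub_zero, abs_zero, mul_zero, zero_add]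
      linarith
  unfold diag
  rw [← sum_sub_distrib]
  refine (abs_sum_le_sum_abs _ _).trans ((sum_le_sum fun s _ => hterm s).trans ?_)
  rw [sum_add_distrib, sum_add_distrib, ← mul_sum, sum_const, card_range, nsmul_eq_mul, mul_one]
  have : ∑ s ∈ range (idx n + 1), (if s < s₁ then (runs s : ℝ) else 0) ≤ C := by
    rw [← sum_filter]
    simp only [C]
    push_cast
    exact sum_le_sum_of_subset_of_nonneg (fun i hi => by simp at hi ⊢; exact hi.2)
      fun _ _ _ => by positivity
  push_cast at this ⊢
  linarith

/-- Blocks of length `k` occur `(2 - χ k) ^ k` times as often as expected. -/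
lemma tendsto_cnt_div_wtSum (hχ : ∀ k, χ k ≤ 1) {k : ℕ} (hk : 0 < k) (B : Fin k → ℕ) :
    Tendsto (fun n => (cnt 1 0 1 k B n : ℝ) / wtSum χ 1 0 k n) atTop
      (𝓝 (((2 - χ k : ℕ) : ℝ) ^ k)) := by
  have hw : ∀ᶠ n in atTop, ∀ a < idx n, len a = k → (1 : ℝ) * mult a ≤ diag 0 0 k n :=
    Eventually.of_forall fun n a ha hl => by rw [one_mul]; exact le_diag ha hl
  have hpos : ∀ᶠ n in atTop, 0 < diag 0 0 k n := by
    filter_upwards [eventually_exists_len (L := k) hk] with n hn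
    obtain ⟨a, ha, hl⟩ := hn
    exact lt_of_lt_of_le (by exact_mod_cast mult_pos a) (le_diag ha hl)
  have hχk := hχ k
  have hτ : (0 : ℝ) < ((2 - χ k : ℕ) : ℝ) := by exact_mod_cast (by omega : 0 < 2 - χ k)
  set c : ℝ := 1 / ((2 - χ k : ℕ) : ℝ) ^ k with hc
  have hc0 : 0 < c := by positivity
  have h1 : (fun n => (cnt 1 0 1 k B n : ℝ)) ~[atTop] diag 0 0 k := by
    refine (cnt_isEquivalent one_pos one_pos hk B).trans ?_
    refine isLittleO_of_anchor (C := 1) hk one_pos hw (Eventually.of_forall fun n => ?_)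
    have := abs_winMain_sub_diag_le hk n
    have h5 : (0 : ℝ) ≤ errSum (idx n) := by positivity
    rw [Pi.sub_apply]
    linarith
  have h2 : (fun n => wtSum χ 1 0 k n - c * diag 1 2 k n) =o[atTop] diag 0 0 k := by
    obtain ⟨K, hK⟩ := abs_wtSum_sub_wtMain_le hχ (m := 1) (r := 0) one_pos hk
    refine isLittleO_of_anchor (C := K + 1) hk one_pos hw (Eventually.of_forall fun n => ?_)
    have i1 := abs_wtMain_sub_diag_le hχ hk n
    have i2 := hK n
    have i3 := const_le_errSum (K := K) (by positivity) (idx n) k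
    have i4 : (0 : ℝ) ≤ errSum (idx n) := by positivity
    rw [abs_le] at *
    constructor <;> linarith
  have t1 : Tendsto (fun n => (cnt 1 0 1 k B n : ℝ) / diag 0 0 k n) atTop (𝓝 1) :=
    (isEquivalent_iff_tendsto_one (hpos.mono fun _ h => h.ne')).1 h1
  have t2 : Tendsto (fun n => diag 1 2 k n / diag 0 0 k n) atTop (𝓝 1) :=
    (isEquivalent_iff_tendsto_one (hpos.mono fun _ h => h.ne')).1 (diag_isEquivalent hk)
  have t3 : Tendsto (fun n => wtSum χ 1 0 k n / diag 0 0 k n) atTop (𝓝 c) := by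
    have := h2.tendsto_div_nhds_zero.add (t2.const_mul c)
    rw [zero_add, mul_one] at this
    refine this.congr fun n => ?_
    ring
  have := t1.div t3 hc0.ne'
  have hc1 : 1 / c = ((2 - χ k : ℕ) : ℝ) ^ k := by rw [hc, one_div_one_div]
  rw [hc1] at this
  refine this.congr' (hpos.mono fun n h => ?_)
  simp only [Pi.div_apply]
  field_simp

/-- The real number with digits `E` in the Cantor series expansion along `q`. -/
noncomputable def value (q E : ℕ → ℕ) : ℝ :=
  ∑' t : ℕ, (E t : ℝ) / ∏ i ∈ Finset.range (t + 1), (q i : ℝ)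

/-- The integer with digits `E 0, …, E (n - 1)`. -/
def numer (q E : ℕ → ℕ) : ℕ → ℕ
  | 0 => 0
  | n + 1 => numer q E n * q n + E n

lemma cast_pos_of_digit_lt {q E : ℕ → ℕ} (hE : ∀ n, E n + 1 < q n) (n : ℕ) : (0 : ℝ) < q n := by
  have := hE n
  exact_mod_cast (by omega : 0 < q n)

lemma partial_sum_le {q E : ℕ → ℕ} (hE : ∀ n, E n + 1 < q n) (n : ℕ) :
    ∑ t ∈ range n, (E t : ℝ) / ∏ i ∈ range (t + 1), (q i : ℝ)
      ≤ 1 - 1 / ∏ i ∈ range n, (q i : ℝ) := by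
  induction n with
  | zero => simp
  | succ n ih =>
    rw [sum_range_succ]
    have hp : 0 < ∏ i ∈ range n, (q i : ℝ) := prod_pos fun i _ => cast_pos_of_digit_lt hE i
    have hq := cast_pos_of_digit_lt hE n
    have h1 : (E n : ℝ) + 1 ≤ q n := by exact_mod_cast (hE n).le
    have h2 : (E n : ℝ) / ∏ i ∈ range (n + 1), (q i : ℝ) + 1 / ∏ i ∈ range (n + 1), (q i : ℝ)
        ≤ 1 / ∏ i ∈ range n, (q i : ℝ) := by
      rw [← add_div, prod_range_succ, div_le_div_iff₀ (by positivity) hp]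
      nlinarith
    linarith

lemma value_term_nonneg (q E : ℕ → ℕ) (t : ℕ) :
    0 ≤ (E t : ℝ) / ∏ i ∈ range (t + 1), (q i : ℝ) := by positivity

lemma partial_sum_le_one {q E : ℕ → ℕ} (hE : ∀ n, E n + 1 < q n) (n : ℕ) :
    ∑ t ∈ range n, (E t : ℝ) / ∏ i ∈ range (t + 1), (q i : ℝ) ≤ 1 := by
  have h := partial_sum_le hE n
  have : 0 ≤ 1 / ∏ i ∈ range n, (q i : ℝ) := by positivity
  linarith

lemma value_nonneg (q E : ℕ → ℕ) : 0 ≤ value q E := tsum_nonneg (value_term_nonneg q E)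

lemma value_le_one {q E : ℕ → ℕ} (hE : ∀ n, E n + 1 < q n) : value q E ≤ 1 :=
  Real.tsum_le_of_sum_range_le (value_term_nonneg q E) (partial_sum_le_one hE)

lemma mul_value {q E : ℕ → ℕ} (hE : ∀ n, E n + 1 < q n) :
    (q 0 : ℝ) * value q E = E 0 + value (fun t => q (t + 1)) fun t => E (t + 1) := by
  have hs : Summable fun t : ℕ => (E t : ℝ) / ∏ i ∈ Finset.range (t + 1), (q i : ℝ) :=
    summable_of_sum_range_le (value_term_nonneg q E) (partial_sum_le_one hE)
  have hq := cast_pos_of_digit_lt hE 0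
  unfold value
  rw [hs.tsum_eq_zero_add, mul_add, ← tsum_mul_left]
  congr 1
  · simp only [zero_add, prod_range_one]
    field_simp
  · refine tsum_congr fun t => ?_
    rw [prod_range_succ' _ (t + 1)]
    have : 0 < ∏ i ∈ range (t + 1), (q (i + 1) : ℝ) :=
      prod_pos fun i _ => cast_pos_of_digit_lt hE _
    field_simp

lemma value_lt_one {q E : ℕ → ℕ} (hE : ∀ n, E n + 1 < q n) : value q E < 1 := by
  have h1 := mul_value hE
  have h2 := value_le_one (q := fun t => q (t + 1)) (E := fun t => E (t + 1)) fun n => hE _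
  have h3 : (E 0 : ℝ) + 1 < q 0 := by exact_mod_cast hE 0
  by_contra hc
  push Not at hc
  have hq := cast_pos_of_digit_lt hE 0
  nlinarith

lemma qprod_mul_value {q E : ℕ → ℕ} (hE : ∀ n, E n + 1 < q n) (n : ℕ) :
    qprod q n * value q E = numer q E n + value (fun t => q (t + n)) fun t => E (t + n) := by
  induction n with
  | zero => simp [qprod, numer]
  | succ n ih =>
    have h1 := mul_value (q := fun t => q (t + n)) (E := fun t => E (t + n)) fun _ => hE _
    simp only [zero_add] at h1
    have h2 : qprod q (n + 1) = q n * qprod q n := by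
      unfold qprod; rw [prod_range_succ, mul_comm]
    rw [h2, mul_assoc, ih, mul_add, h1, numer]
    have h3 : ∀ t, t + 1 + n = t + (n + 1) := fun t => by ring
    simp only [h3]
    push_cast
    ring

lemma qdigit_value {q E : ℕ → ℕ} (hE : ∀ n, E n + 1 < q n) (n : ℕ) :
    qdigit q (value q E) n = E n := by
  have h0 : ∀ n, 0 ≤ value (fun t => q (t + n)) (fun t => E (t + n)) ∧
      value (fun t => q (t + n)) (fun t => E (t + n)) < 1 :=
    fun n => ⟨value_nonneg _ _, value_lt_one fun _ => hE _⟩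
  have h1 := mul_value (q := fun t => q (t + n)) (E := fun t => E (t + n)) fun _ => hE _
  simp only [zero_add] at h1
  have h3 : ∀ t, t + 1 + n = t + (n + 1) := fun t => by ring
  simp only [h3] at h1
  unfold qdigit TQ
  rw [qprod_mul_value hE, Int.fract_natCast_add, Int.fract_eq_self.2 (h0 n), h1,
    add_comm, Nat.floor_add_natCast (h0 (n + 1)).1, Nat.floor_eq_zero.2 (h0 (n + 1)).2, zero_add]

lemma digit_le (i : ℕ) : digit i ≤ base (idx i) := by
  unfold digit
  split_ifs
  · exact (Nat.mod_lt _ (by have := two_le_base (idx i); omega)).le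
  · exact le_rfl

lemma digit_succ_lt {χ : ℕ → ℕ} (hχ : ∀ k, χ k ≤ 1) (i : ℕ) : digit i + 1 < bseq χ i := by
  have h1 := digit_le i
  have h2 := two_le_bseq hχ i
  omega

/-- The number with digit sequence `digit`. -/
noncomputable def point (χ : ℕ → ℕ) : ℝ := value (bseq χ) digit

lemma qdigit_point {χ : ℕ → ℕ} (hχ : ∀ k, χ k ≤ 1) (n : ℕ) :
    qdigit (bseq χ) (point χ) n = digit n := qdigit_value (digit_succ_lt hχ) n

lemma qdigit_Ups_point {χ : ℕ → ℕ} (hχ : ∀ k, χ k ≤ 1) (m r t : ℕ) :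
    qdigit (lamQ (bseq χ) m r) (Ups (bseq χ) m r (point χ)) t = digit (m * t + r) := by
  have : Ups (bseq χ) m r (point χ) = value (lamQ (bseq χ) m r) fun t => digit (m * t + r) := by
    unfold Ups value
    simp only [qdigit_point hχ]
  rw [this]
  exact qdigit_value (fun t => digit_succ_lt hχ _) t

lemma apCount_point {χ : ℕ → ℕ} (hχ : ∀ k, χ k ≤ 1) (m r n : ℕ) (B : Fin m → ℕ) :
    apCount (bseq χ) (point χ) m r B n = cnt m r 1 m B n := by
  unfold apCount cnt
  simp only [qdigit_point hχ, mul_one]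

lemma blockCount_point {χ : ℕ → ℕ} (hχ : ∀ k, χ k ≤ 1) (k n : ℕ) (B : Fin k → ℕ) :
    blockCount (bseq χ) (point χ) B n = cnt 1 0 1 k B n := by
  unfold blockCount cnt
  simp only [qdigit_point hχ, mul_one, Nat.mod_one, true_and]

/-- Summing over a residue class is summing along the corresponding progression. -/
lemma sum_residue {m r : ℕ} (hr : r < m) (f : ℕ → ℝ) (n : ℕ) :
    ∑ i ∈ range (m * n), (if i % m = r then f i else 0) = ∑ t ∈ range n, f (m * t + r) := by
  rw [← sum_filter]
  symm
  refine sum_nbij (fun t => m * t + r) ?_ ?_ ?_ fun _ _ => rfl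
  · intro t ht
    simp only [mem_range, mem_filter] at ht ⊢
    exact ⟨by nlinarith, by rw [Nat.mul_add_mod, Nat.mod_eq_of_lt hr]⟩
  · intro a _ b _ h
    have h' : m * a + r = m * b + r := h
    exact Nat.eq_of_mul_eq_mul_left (by omega : 0 < m) (by omega)
  · intro i hi
    simp only [coe_filter, mem_range, Set.mem_ofPred_eq, Set.mem_image, coe_range,
      Set.mem_Iio] at hi ⊢
    refine ⟨i / m, Nat.div_lt_of_lt_mul hi.1, ?_⟩
    rw [← hi.2]
    exact Nat.div_add_mod i m

lemma blockCount_Ups_point {χ : ℕ → ℕ} (hχ : ∀ k, χ k ≤ 1) {m r : ℕ} (hr : r < m) (k n : ℕ)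
    (B : Fin k → ℕ) :
    blockCount (lamQ (bseq χ) m r) (Ups (bseq χ) m r (point χ)) B n
      = cnt m r m k B (m * n) := by
  have h := sum_residue hr
    (fun i => if ∀ j : Fin k, digit (i + (j : ℕ) * m) = B j then 1 else 0) n
  have h1 : (blockCount (lamQ (bseq χ) m r) (Ups (bseq χ) m r (point χ)) B n : ℝ)
      = cnt m r m k B (m * n) := by
    unfold blockCount cnt
    rw [card_filter, card_filter]
    push_cast
    simp only [qdigit_Ups_point hχ]
    simp only [ite_and]
    rw [h]
    refine sum_congr rfl fun t _ => ?_
    have : ∀ j : ℕ, m * (t + j) + r = m * t + r + j * m := fun j => by ring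
    simp only [this]
  exact_mod_cast h1

lemma wtSum_mul_eq {χ : ℕ → ℕ} {m r : ℕ} (hr : r < m) (k n : ℕ) :
    wtSum χ m r k (m * n) = ∑ t ∈ range n, wt χ k (m * t + r) := sum_residue hr _ n

lemma Qsum_eq_wtSum (χ : ℕ → ℕ) (k n : ℕ) : Qsum (bseq χ) k n = wtSum χ 1 0 k n := by
  unfold Qsum wtSum wt
  simp only [Nat.mod_one, if_true]

lemma Qsum_lamQ_one {χ : ℕ → ℕ} {m r : ℕ} (hr : r < m) (n : ℕ) :
    Qsum (lamQ (bseq χ) m r) 1 n = wtSum χ m r 1 (m * n) := by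
  rw [wtSum_mul_eq hr]
  unfold Qsum wt lamQ
  simp

lemma apQsum_eq_wtSum (χ : ℕ → ℕ) {m r n : ℕ} (hr : r < m) (hn : r ≤ n) :
    apQsum (bseq χ) m r n = wtSum χ m r m (n + 1) := by
  have h : wtSum χ m r m (n + 1) = wtSum χ m r m (m * ((n - r) / m + 1)) := by
    have hm : 0 < m := by omega
    have h1 := Nat.div_add_mod (n - r) m
    have h2 := Nat.mod_lt (n - r) hm
    set t := (n - r) / m with ht
    have hsub : n < m * (t + 1) + r := by rw [mul_add]; omega
    unfold wtSum
    rw [← sum_filter, ← sum_filter]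
    congr 1
    ext i
    simp only [mem_filter, mem_range]
    refine and_congr_left fun hi => ?_
    have h3 := Nat.div_add_mod i m
    rw [hi] at h3
    have h4 : i < m * (t + 1) ↔ i / m < t + 1 := by
      rw [mul_comm, Nat.div_lt_iff_lt_mul hm]
    rw [h4, ht, Nat.lt_succ_iff, Nat.lt_succ_iff, Nat.le_div_iff_mul_le hm, mul_comm]
    omega
  rw [h, wtSum_mul_eq hr]
  rfl

lemma isBasic_bseq (hχ : ∀ k, χ k ≤ 1) : IsBasic (bseq χ) := fun i => by
  have := two_le_bseq hχ i
  omega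

lemma infiniteInLimit_bseq (hχ : ∀ k, χ k ≤ 1) : InfiniteInLimit (bseq χ) := by
  refine tendsto_atTop_mono (fun i => ?_) (tendsto_stage.comp tendsto_idx)
  have := two_le_bseq hχ i
  unfold base at this
  simp only [Function.comp_apply]
  omega

lemma memRNI_point (hχ : ∀ k, χ k ≤ 1) : MemRNI (bseq χ) (point χ) := by
  intro m hm r hr B₁ B₂
  simp only [apCount_point hχ]
  exact tendsto_cnt_div_cnt hr one_pos (by omega) B₁ B₂

lemma tendsto_mul_left_atTop {m : ℕ} (hm : 0 < m) : Tendsto (fun n => m * n) atTop atTop :=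
  tendsto_atTop_mono (fun n => Nat.le_mul_of_pos_left n hm) tendsto_id

lemma memRNII_point (hχ : ∀ k, χ k ≤ 1) : MemRNII (bseq χ) (point χ) := by
  intro k hk m hm r hr B₁ B₂
  simp only [blockCount_Ups_point hχ hr]
  exact (tendsto_cnt_div_cnt hr hm hk B₁ B₂).comp (tendsto_mul_left_atTop hm)

lemma wtSum_le_succ (hχ : ∀ k, χ k ≤ 1) (m r k n : ℕ) :
    wtSum χ m r k n ≤ wtSum χ m r k (n + 1) ∧ wtSum χ m r k (n + 1) ≤ wtSum χ m r k n + 1 := by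
  unfold wtSum
  rw [sum_range_succ]
  have h1 := (wt_pos hχ k n).le
  have h2 := wt_le_one hχ k n
  split_ifs <;> constructor <;> linarith

lemma wtSum_nonneg (hχ : ∀ k, χ k ≤ 1) (m r k n : ℕ) : 0 ≤ wtSum χ m r k n :=
  sum_nonneg fun i _ => by
    have := (wt_pos hχ k i).le
    split_ifs <;> linarith

lemma apAbnormalI_point (hχ : ∀ k, χ k ≤ 1) : APAbnormalI (bseq χ) (point χ) := by
  intro m hm r hr hmem
  have h1 := hmem fun _ => 0
  simp only [apCount_point hχ] at h1
  rcases Nat.eq_zero_or_pos r with rfl | hr1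
  · have h2 : (fun n => apQsum (bseq χ) m 0 n) =o[atTop]
        fun n => (cnt m 0 1 m (fun _ => 0) n : ℝ) := by
      refine IsBigO.trans_isLittleO (IsBigO.of_bound 1 (Eventually.of_forall fun n => ?_))
        (wtSum_isLittleO_cnt hχ hm fun _ => 0)
      rw [apQsum_eq_wtSum χ hr (Nat.zero_le n), Real.norm_eq_abs, Real.norm_eq_abs,
        abs_of_nonneg (wtSum_nonneg hχ _ _ _ _),
        abs_of_nonneg (by have := wtSum_nonneg hχ m 0 m n; linarith), one_mul]
      exact (wtSum_le_succ hχ m 0 m n).2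
    have h3 := h2.tendsto_div_nhds_zero
    have h4 := h1.inv₀ one_ne_zero
    simp only [inv_div, inv_one] at h4
    exact zero_ne_one (tendsto_nhds_unique h3 h4)
  · have h2 : (fun n => (cnt m r 1 m (fun _ => 0) n : ℝ)) =o[atTop]
        fun n => apQsum (bseq χ) m r n := by
      refine (cnt_isLittleO_wtSum hχ hr hr1 one_pos (by omega) fun _ => 0).trans_isBigO
        (IsBigO.of_bound 1 ?_)
      filter_upwards [eventually_ge_atTop r] with n hn
      rw [apQsum_eq_wtSum χ hr hn, Real.norm_eq_abs, Real.norm_eq_abs,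
        abs_of_nonneg (wtSum_nonneg hχ _ _ _ _), abs_of_nonneg (wtSum_nonneg hχ _ _ _ _), one_mul]
      exact (wtSum_le_succ hχ m r m n).1
    exact zero_ne_one (tendsto_nhds_unique h2.tendsto_div_nhds_zero h1)

lemma not_apNormalII_point (hχ : ∀ k, χ k ≤ 1) : ¬ APNormalII (bseq χ) (point χ) := by
  intro h
  have h1 := h 1 le_rfl 2 (by omega) 1 (by omega) fun _ => 0
  simp only [blockCount_Ups_point hχ one_lt_two, Qsum_lamQ_one one_lt_two] at h1
  have h2 := (cnt_isLittleO_wtSum hχ (m := 2) (r := 1) (d := 2) (k := 1) one_lt_two le_rfl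
    two_pos one_pos fun _ => 0).tendsto_div_nhds_zero.comp (tendsto_mul_left_atTop two_pos)
  exact zero_ne_one (tendsto_nhds_unique h2 h1)

lemma tendsto_blockCount_point (hχ : ∀ k, χ k ≤ 1) {k : ℕ} (hk : 0 < k) (B : Fin k → ℕ) :
    Tendsto (fun n => (blockCount (bseq χ) (point χ) B n : ℝ) / Qsum (bseq χ) k n) atTop
      (𝓝 (((2 - χ k : ℕ) : ℝ) ^ k)) := by
  simp only [blockCount_point hχ, Qsum_eq_wtSum]
  exact tendsto_cnt_div_wtSum hχ hk B

lemma qNormalOfOrder_point_iff (hχ : ∀ k, χ k ≤ 1) {k : ℕ} (hk : 0 < k) :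
    QNormalOfOrder (bseq χ) k (point χ) ↔ χ k = 1 := by
  have hk1 := hχ k
  constructor
  · intro h
    have h1 := tendsto_nhds_unique (h fun _ => 0) (tendsto_blockCount_point hχ hk fun _ => 0)
    by_contra hc
    have h2 : 2 - χ k = 2 := by omega
    rw [h2] at h1
    have : (1 : ℝ) < 2 ^ k := one_lt_pow₀ one_lt_two hk.ne'
    push_cast at h1
    linarith
  · intro h B
    have := tendsto_blockCount_point hχ hk B
    rw [h] at this
    simpa using this

lemma primrec_pow {f g : ℕ → ℕ} (hf : Primrec f) (hg : Primrec g) :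
    Primrec fun n => f n ^ g n := by
  have h : Primrec₂ fun a b : ℕ => a ^ b := by
    refine (Primrec.nat_rec (f := fun _ : ℕ => 1) (g := fun a p => p.2 * a) (Primrec.const 1)
      (Primrec.nat_mul.comp (Primrec.snd.comp Primrec.snd) Primrec.fst)).of_eq fun a b => ?_
    induction b with
    | zero => rfl
    | succ b ih => rw [pow_succ, ← ih]
  exact h.comp hf hg

lemma primrec_factorial : Primrec Nat.factorial := by
  refine (Primrec.nat_rec₁ (f := fun n r => (n + 1) * r) 1
    (Primrec.nat_mul.comp (Primrec.succ.comp Primrec.fst) Primrec.snd)).of_eq fun n => ?_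
  induction n with
  | zero => rfl
  | succ n ih => rw [Nat.factorial_succ, ← ih]

lemma primrec_add_const {f : ℕ → ℕ} (hf : Primrec f) (c : ℕ) : Primrec fun n => f n + c :=
  Primrec.nat_add.comp hf (Primrec.const c)

lemma primrec_stage : Primrec stage := Primrec.nat_sqrt

lemma primrec_len : Primrec len :=
  Primrec.nat_sub.comp Primrec.id (Primrec.nat_mul.comp primrec_stage primrec_stage)

lemma primrec_base : Primrec base := primrec_add_const primrec_stage 2

lemma primrec_growth : Primrec growth :=
  primrec_pow (primrec_add_const Primrec.id 3)
    (primrec_add_const (Primrec.nat_mul.comp (Primrec.const 2) Primrec.id) 7)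

lemma primrec_mult : Primrec mult :=
  primrec_pow (primrec_growth.comp primrec_stage) (Primrec.nat_sub.comp
    (primrec_add_const (Primrec.nat_mul.comp (Primrec.const 2) primrec_stage) 1) primrec_len)

lemma primrec_runs : Primrec runs :=
  Primrec.nat_mul.comp primrec_mult (primrec_pow primrec_base primrec_len)

lemma primrec_gap : Primrec gap := primrec_factorial.comp (primrec_add_const Primrec.id 3)

lemma primrec_start : Primrec start := by
  have h : Primrec₂ fun s r : ℕ => (r + runs s * gap s) * (s + 1).factorial :=
    Primrec.nat_mul.comp
      (Primrec.nat_add.comp Primrec.snd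
        (Primrec.nat_mul.comp (primrec_runs.comp Primrec.fst) (primrec_gap.comp Primrec.fst)))
      (primrec_factorial.comp (Primrec.succ.comp Primrec.fst))
  refine (Primrec.nat_rec₁ 0 h).of_eq fun n => ?_
  induction n with
  | zero => rfl
  | succ n ih => rw [start, ← ih]

lemma primrec_idx : Primrec idx := by
  have h : Primrec₂ fun i r : ℕ => if start (r + 1) ≤ i + 1 then r + 1 else r :=
    Primrec.ite (Primrec.nat_le.comp (primrec_start.comp (Primrec.succ.comp Primrec.snd))
      (Primrec.succ.comp Primrec.fst)) (Primrec.succ.comp Primrec.snd) Primrec.snd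
  refine (Primrec.nat_rec₁ 0 h).of_eq fun n => ?_
  induction n with
  | zero => rfl
  | succ n ih => rw [idx, ← ih]

lemma primrec_cell : Primrec cell :=
  Primrec.nat_div.comp (Primrec.nat_sub.comp Primrec.id (primrec_start.comp primrec_idx))
    (primrec_gap.comp primrec_idx)

lemma primrec_off : Primrec off :=
  Primrec.nat_mod.comp (Primrec.nat_sub.comp Primrec.id (primrec_start.comp primrec_idx))
    (primrec_gap.comp primrec_idx)

lemma primrec_digit : Primrec digit := by
  have hb := primrec_base.comp primrec_idx
  exact (Primrec.ite ((Primrec.nat_lt.comp primrec_cell (primrec_runs.comp primrec_idx)).and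
      (Primrec.nat_lt.comp primrec_off (primrec_len.comp primrec_idx)))
    (Primrec.nat_mod.comp (Primrec.nat_div.comp primrec_cell (primrec_pow hb primrec_off)) hb)
    hb).of_eq fun i => by unfold digit; congr

lemma computable_bseq (hc : Computable χ) : Computable (bseq χ) := by
  have hp : PrimrecPred fun i => cell i < runs (idx i) ∧ 1 ≤ off i ∧ off i ≤ len (idx i) :=
    (Primrec.nat_lt.comp primrec_cell (primrec_runs.comp primrec_idx)).and
      ((Primrec.nat_le.comp (Primrec.const 1) primrec_off).and
        (Primrec.nat_le.comp primrec_off (primrec_len.comp primrec_idx)))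
  have h1 : Computable fun i => (base (idx i) + 2) * (2 - χ (len (idx i))) :=
    Primrec.nat_mul.to_comp.comp (primrec_add_const (primrec_base.comp primrec_idx) 2).to_comp
      (Primrec.nat_sub.to_comp.comp (Computable.const 2)
        (hc.comp (primrec_len.comp primrec_idx).to_comp))
  have h2 : Computable fun i : ℕ => (i + 4).factorial :=
    (primrec_factorial.comp (primrec_add_const Primrec.id 4)).to_comp
  refine (Computable.cond hp.decide.to_comp h1 h2).of_eq fun i => ?_
  unfold bseq
  rw [Bool.cond_decide]

lemma computable_numer {q E : ℕ → ℕ} (hq : Computable q) (hE : Computable E) :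
    Computable (numer q E) := by
  have h : Computable₂ fun (_ : ℕ) (p : ℕ × ℕ) => p.2 * q p.1 + E p.1 :=
    Primrec.nat_add.to_comp.comp
      (Primrec.nat_mul.to_comp.comp (Computable.snd.comp Computable.snd)
        (hq.comp (Computable.fst.comp Computable.snd)))
      (hE.comp (Computable.fst.comp Computable.snd))
  refine (Computable.nat_rec Computable.id (Computable.const 0) h).of_eq fun n => ?_
  simp only [id_eq]
  induction n with
  | zero => rfl
  | succ n ih => rw [numer, ← ih]

lemma computable_prod {q : ℕ → ℕ} (hq : Computable q) :
    Computable fun n => ∏ i ∈ range n, q i := by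
  have h : Computable₂ fun (_ : ℕ) (p : ℕ × ℕ) => p.2 * q p.1 :=
    Primrec.nat_mul.to_comp.comp (Computable.snd.comp Computable.snd)
        (hq.comp (Computable.fst.comp Computable.snd))
  refine (Computable.nat_rec Computable.id (Computable.const 1) h).of_eq fun n => ?_
  simp only [id_eq]
  induction n with
  | zero => rfl
  | succ n ih => rw [prod_range_succ, ← ih]

lemma dvd_prod_bseq {n : ℕ} (hn : 0 < n) : n ∣ ∏ i ∈ range (start n + 1), bseq χ i := by
  have h : bseq χ (start n) = (start n + 4).factorial := by
    have h0 := off_coord (s := n) (u := 0) (o := 0) (runs_pos n) (gap_pos n)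
    simp only [zero_mul, add_zero] at h0
    unfold bseq
    rw [h0, if_neg (by omega)]
  rw [prod_range_succ, h]
  have := le_start n
  exact Dvd.dvd.mul_left (Nat.dvd_factorial hn (by omega)) _

lemma computableReal_point (hχ : ∀ k, χ k ≤ 1) (hc : Computable χ) :
    ComputableReal (point χ) := by
  have hq := computable_bseq hc
  have hN : Computable fun n => start n + 1 := (primrec_add_const primrec_start 1).to_comp
  refine ⟨fun n => numer (bseq χ) digit (start n + 1) /
    ((∏ i ∈ range (start n + 1), bseq χ i) / n), ?_, ?_⟩
  · exact Primrec.nat_div.to_comp.comp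
      ((computable_numer hq primrec_digit.to_comp).comp hN)
      (Primrec.nat_div.to_comp.comp ((computable_prod hq).comp hN) Computable.id)
  · intro n hn
    have hE := digit_succ_lt hχ
    obtain ⟨e, he⟩ := dvd_prod_bseq (χ := χ) hn
    have hpos : 0 < ∏ i ∈ range (start n + 1), bseq χ i :=
      prod_pos fun i _ => by have := hE i; omega
    have he0 : 0 < e := by
      rcases Nat.eq_zero_or_pos e with rfl | h
      · rw [mul_zero] at he; omega
      · exact h
    have hval := qprod_mul_value hE (start n + 1)
    have hq' : qprod (bseq χ) (start n + 1) = n * e := by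
      unfold qprod
      exact_mod_cast he
    have t0 := value_nonneg (fun t => bseq χ (t + (start n + 1)))
      fun t => digit (t + (start n + 1))
    have t1 := value_lt_one (q := fun t => bseq χ (t + (start n + 1)))
      (E := fun t => digit (t + (start n + 1))) fun _ => hE _
    set p := numer (bseq χ) digit (start n + 1) with hp
    dsimp only
    rw [he, Nat.mul_div_cancel_left _ hn, ← hp]
    have hn' : (0 : ℝ) < n := by exact_mod_cast hn
    have he' : (0 : ℝ) < e := by exact_mod_cast he0
    have f1 : (e : ℝ) * (p / e : ℕ) ≤ p := by exact_mod_cast Nat.mul_div_le p e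
    have f2 : (p : ℝ) + 1 ≤ e * ((p / e : ℕ) + 1) := by
      exact_mod_cast Nat.lt_mul_div_succ p he0
    rw [hq'] at hval
    change (n : ℝ) * e * point χ = _ at hval
    constructor
    · rw [div_le_iff₀ hn']
      refine le_of_mul_le_mul_left ?_ he'
      linarith
    · rw [le_div_iff₀ hn']
      refine le_of_mul_le_mul_left ?_ he'
      linarith

end CellSeq

/-- If `S` is almost closed under addition and its indicator function is computable, then
there exist a computable, infinite in limit basic sequence `Q` and a computable real
number in
`RN^{I}(Q) ∩ RN^{II}(Q) ∩ N^{I}_{Ab}(Q) ∩ ⋂_{k∈S} N_k(Q) \ (N^{II}(Q) ∪ ⋃_{k∉S} N_k(Q))`. -/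
theorem stmt8 (S : Set ℕ) (hSpos : 0 ∉ S) (hS : AlmostClosed S)
    (hScomp : Computable fun k : ℕ => if k ∈ S then (1 : ℕ) else 0) :
    ∃ Q : ℕ → ℕ, Computable Q ∧ IsBasic Q ∧ InfiniteInLimit Q ∧
      ∃ x : ℝ, ComputableReal x ∧
        x ∈ (({x : ℝ | MemRNI Q x} ∩ {x : ℝ | MemRNII Q x} ∩
          {x : ℝ | APAbnormalI Q x} ∩ (⋂ k ∈ S, {x : ℝ | QNormalOfOrder Q k x})) \
          ({x : ℝ | APNormalII Q x} ∪
            ⋃ k ∈ {k : ℕ | 1 ≤ k ∧ k ∉ S}, {x : ℝ | QNormalOfOrder Q k x})) := by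
  have hχ : ∀ k, (if k ∈ S then (1 : ℕ) else 0) ≤ 1 := fun k => by split_ifs <;> omega
  refine ⟨CellSeq.bseq fun k => if k ∈ S then 1 else 0, CellSeq.computable_bseq hScomp,
    CellSeq.isBasic_bseq hχ, CellSeq.infiniteInLimit_bseq hχ,
    CellSeq.point fun k => if k ∈ S then 1 else 0, CellSeq.computableReal_point hχ hScomp,
    ⟨⟨⟨CellSeq.memRNI_point hχ, CellSeq.memRNII_point hχ⟩, CellSeq.apAbnormalI_point hχ⟩, ?_⟩, ?_⟩
  · refine Set.mem_iInter₂.2 fun k hk => ?_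
    have hk0 : 0 < k := Nat.pos_of_ne_zero fun h => hSpos (h ▸ hk)
    exact (CellSeq.qNormalOfOrder_point_iff hχ hk0).2 (if_pos hk)
  · rintro (h | h)
    · exact CellSeq.not_apNormalII_point hχ h
    · obtain ⟨k, ⟨hk1, hkS⟩, hk⟩ := Set.mem_iUnion₂.1 h
      have h1 := (CellSeq.qNormalOfOrder_point_iff hχ hk1).1 hk
      simp [hkS] at h1
end

section
/- Let S be a set of positive integers almost closed under addition, let ε > 0, and define the coefficients c_{t,i} as in the context. Then for every positive integer k, the quotient (Σ_{i=1}^{t−k+1} c_{t,i} c_{t,i+1} ⋯ c_{t,i+k−1}) / (2t) converges to 1 as t → ∞ if k ∈ S, and does not converge to 1 if k ∉ S. -/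
open Filter MeasureTheory Finset
open scoped Topology Classical

lemma indZ_mem_cases (S : Set ℕ) (i : ℕ) : indZ S i = 0 ∨ indZ S i = 1 := by
  unfold indZ; split_ifs <;> simp

lemma prod_coeff_of_pos (S : Set ℕ) {ε : ℝ} (hε : 0 < ε) (t : ℕ) {m : ℕ} (hm : 1 ≤ m) (k : ℕ) :
    ∏ j ∈ Finset.range k, coeff S ε t (m + 1 + j) = (1 + ε) ^ (indZ S (m + k) - indZ S m) := by
  induction k with
  | zero => simp
  | succ k ih =>
    have h : m + 1 + k ≠ 1 := by omega
    rw [Finset.prod_range_succ, ih, coeff, if_neg h, ← zpow_add₀ (by positivity),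
      show m + 1 + k - 1 = m + k by omega, show m + 1 + k = m + (k + 1) by omega]
    congr 1
    ring

lemma prod_coeff_one (S : Set ℕ) {ε : ℝ} (hε : 0 < ε) (t : ℕ) {k : ℕ} (hk : 1 ≤ k) :
    ∏ j ∈ Finset.range k, coeff S ε t (1 + j) = t * (1 + ε) ^ indZ S k := by
  induction k, hk using Nat.le_induction with
  | base => simp [coeff]
  | succ k hk ih =>
    have h : 1 + k ≠ 1 := by omega
    rw [Finset.prod_range_succ, ih, coeff, if_neg h, mul_assoc, ← zpow_add₀ (by positivity),
      show 1 + k - 1 = k by omega, add_comm 1 k]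
    congr 2
    ring

/-- On `{-1, 0, 1}` the function `d ↦ a ^ d` is affine up to a correction at `-1`. -/
lemma zpow_indZ_sub {a : ℝ} (S : Set ℕ) (x y : ℕ) :
    a ^ (indZ S y - indZ S x) = 1 + (a - 1) * ((indZ S y - indZ S x : ℤ) : ℝ) +
      (a + a⁻¹ - 2) * (if x ∉ S ∧ y ∈ S then 1 else 0) := by
  by_cases hx : x ∈ S <;> by_cases hy : y ∈ S <;> simp [indZ, hx, hy]
  ring

lemma abs_sum_indZ_shift_le (S : Set ℕ) (n k : ℕ) :
    |∑ x ∈ Finset.range n, (indZ S (x + 1 + k) - indZ S (x + 1))| ≤ k := by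
  induction k with
  | zero => simp
  | succ k ih =>
    have h : ∑ x ∈ Finset.range n, (indZ S (x + 1 + (k + 1)) - indZ S (x + 1)) =
        (indZ S (n + 1 + k) - indZ S (0 + 1 + k)) +
          ∑ x ∈ Finset.range n, (indZ S (x + 1 + k) - indZ S (x + 1)) := by
      rw [← Finset.sum_range_sub (fun x => indZ S (x + 1 + k)), ← Finset.sum_add_distrib]
      refine Finset.sum_congr rfl fun x _ => ?_
      rw [show x + 1 + (k + 1) = x + 1 + 1 + k by omega]
      ring
    rw [h]
    rw [abs_le] at ih ⊢
    push_cast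
    rcases indZ_mem_cases S (n + 1 + k) with h1 | h1 <;>
      rcases indZ_mem_cases S (0 + 1 + k) with h2 | h2 <;> constructor <;> linarith

lemma sum_Icc_one_eq_sum_range {M : Type*} [AddCommMonoid M] (f : ℕ → M) (n : ℕ) :
    ∑ i ∈ Finset.Icc 1 n, f i = ∑ x ∈ Finset.range n, f (x + 1) := by
  rw [Finset.range_eq_Ico, Finset.sum_Ico_add' f 0 n 1]
  rfl

lemma sum_prod_coeff (S : Set ℕ) {ε : ℝ} (hε : 0 < ε) (t n : ℕ) {k : ℕ} (hk : 1 ≤ k) :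
    ∑ i ∈ Finset.Icc 1 (n + 1), ∏ j ∈ Finset.range k, coeff S ε t (i + j) =
      t * (1 + ε) ^ indZ S k + n +
        ε * ((∑ x ∈ Finset.range n, (indZ S (x + 1 + k) - indZ S (x + 1)) : ℤ) : ℝ) +
        (1 + ε + (1 + ε)⁻¹ - 2) *
          (((Finset.Icc 1 n).filter fun x => x ∉ S ∧ x + k ∈ S).card : ℝ) := by
  rw [sum_Icc_one_eq_sum_range, Finset.sum_range_succ']
  simp only [zero_add]
  rw [prod_coeff_one S hε t hk, Finset.card_filter, sum_Icc_one_eq_sum_range]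
  have h : ∀ x ∈ Finset.range n, ∏ j ∈ Finset.range k, coeff S ε t (x + 1 + 1 + j) = _ :=
    fun x _ => (prod_coeff_of_pos S hε t (Nat.le_add_left 1 x) k).trans (zpow_indZ_sub S _ _)
  rw [Finset.sum_congr rfl h, Finset.sum_add_distrib, Finset.sum_add_distrib,
    ← Finset.mul_sum, ← Finset.mul_sum]
  push_cast
  simp
  ring

/-- For `S` almost closed under addition and `ε > 0`, the quotient
`(∑_{i=1}^{t-k+1} c_{t,i} c_{t,i+1} ⋯ c_{t,i+k-1}) / (2t)` converges to `1` as `t → ∞`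
if `k ∈ S`, and does not converge to `1` if `k ∉ S`. -/
theorem stmt9 (S : Set ℕ) (hSpos : 0 ∉ S) (hS : AlmostClosed S)
    (ε : ℝ) (hε : 0 < ε) (k : ℕ) (hk : 1 ≤ k) :
    (k ∈ S →
      Tendsto (fun t : ℕ =>
        (∑ i ∈ Finset.Icc 1 (t - k + 1), ∏ j ∈ Finset.range k, coeff S ε t (i + j)) /
          (2 * (t : ℝ))) atTop (𝓝 1)) ∧
    (k ∉ S →
      ¬ Tendsto (fun t : ℕ =>
        (∑ i ∈ Finset.Icc 1 (t - k + 1), ∏ j ∈ Finset.range k, coeff S ε t (i + j)) /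
          (2 * (t : ℝ))) atTop (𝓝 1)) := by
  have hC : 0 ≤ 1 + ε + (1 + ε)⁻¹ - 2 := by
    have h : 1 + ε + (1 + ε)⁻¹ - 2 = ε ^ 2 / (1 + ε) := by
      field_simp
      ring
    rw [h]
    positivity
  have hD : ∀ n, |((∑ x ∈ Finset.range n, (indZ S (x + 1 + k) - indZ S (x + 1)) : ℤ) : ℝ)| ≤ k :=
    fun n => by exact_mod_cast abs_sum_indZ_shift_le S n k
  constructor
  · intro hkS
    have hlim : Tendsto (fun t : ℕ => ((1 + ε) * k / 2) / (t : ℝ) +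
        (1 + ε + (1 + ε)⁻¹ - 2) / 2 *
          ((((Finset.Icc 1 t).filter fun x => x ∉ S ∧ x + k ∈ S).card : ℝ) / t))
        atTop (𝓝 0) := by
      simpa using (tendsto_const_div_atTop_nhds_zero_nat ((1 + ε) * k / 2)).add
        ((hS k hkS).const_mul ((1 + ε + (1 + ε)⁻¹ - 2) / 2))
    rw [tendsto_iff_dist_tendsto_zero]
    refine squeeze_zero' (.of_forall fun _ => dist_nonneg) ?_ hlim
    filter_upwards [eventually_ge_atTop k] with t ht
    have htpos : (0 : ℝ) < t := by exact_mod_cast hk.trans ht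
    have hmono : (((Finset.Icc 1 (t - k)).filter fun x => x ∉ S ∧ x + k ∈ S).card : ℝ) ≤
        (((Finset.Icc 1 t).filter fun x => x ∉ S ∧ x + k ∈ S).card : ℝ) := by
      exact_mod_cast Finset.card_le_card
        (Finset.filter_subset_filter _ (Finset.Icc_subset_Icc_right (Nat.sub_le t k)))
    have hk0 : indZ S k = 0 := if_pos hkS
    rw [sum_prod_coeff S hε t (t - k) hk, Nat.cast_sub ht, Real.dist_eq, hk0, zpow_zero, mul_one]
    have hDt := abs_le.mp (hD (t - k))
    generalize ((∑ x ∈ Finset.range (t - k), (indZ S (x + 1 + k) - indZ S (x + 1)) : ℤ) : ℝ) = d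
      at hDt ⊢
    have hb : (0 : ℝ) ≤
      (((Finset.Icc 1 (t - k)).filter fun x => x ∉ S ∧ x + k ∈ S).card : ℝ) := by positivity
    generalize (((Finset.Icc 1 (t - k)).filter fun x => x ∉ S ∧ x + k ∈ S).card : ℝ) = b
      at hmono hb ⊢
    generalize (((Finset.Icc 1 t).filter fun x => x ∉ S ∧ x + k ∈ S).card : ℝ) = b' at hmono ⊢
    generalize 1 + ε + (1 + ε)⁻¹ - 2 = c at hC ⊢
    have e1 : (t + (t - k) + ε * d + c * b) / (2 * (t : ℝ)) - 1 =
        (-k + ε * d + c * b) / (2 * t) := by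
      field_simp
      ring
    have e2 : (1 + ε) * k / 2 / t + c / 2 * (b' / t) = ((1 + ε) * k + c * b') / (2 * (t : ℝ)) := by
      field_simp
    rw [e1, e2, abs_div, abs_of_pos (by positivity : (0 : ℝ) < 2 * t)]
    gcongr
    have h1 := mul_le_mul_of_nonneg_left hDt.1 hε.le
    have h2 := mul_le_mul_of_nonneg_left hDt.2 hε.le
    have h3 := mul_le_mul_of_nonneg_left hmono hC
    have h4 := mul_nonneg hC hb
    have h5 : (0 : ℝ) ≤ k := by positivity
    rw [abs_le]
    constructor <;> linarith
  · intro hkS hlim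
    have hlow : Tendsto (fun t : ℕ => 1 + ε / 2 - ((1 + ε) * k / 2) / (t : ℝ)) atTop
        (𝓝 (1 + ε / 2)) := by
      simpa using tendsto_const_nhds.sub
        (tendsto_const_div_atTop_nhds_zero_nat ((1 + ε) * k / 2))
    suffices h : 1 + ε / 2 ≤ 1 by linarith
    refine le_of_tendsto_of_tendsto hlow hlim ?_
    filter_upwards [eventually_ge_atTop k] with t ht
    have htpos : (0 : ℝ) < t := by exact_mod_cast hk.trans ht
    have hk1 : indZ S k = 1 := if_neg hkS
    rw [sum_prod_coeff S hε t (t - k) hk, Nat.cast_sub ht, hk1, zpow_one]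
    have h1 := mul_le_mul_of_nonneg_left (abs_le.mp (hD (t - k))).1 hε.le
    have h2 := mul_nonneg hC (Nat.cast_nonneg (α := ℝ)
      ((Finset.Icc 1 (t - k)).filter fun x => x ∉ S ∧ x + k ∈ S).card)
    have e : 1 + ε / 2 - (1 + ε) * k / 2 / t =
        (t * (1 + ε) + (t - k) - ε * k) / (2 * (t : ℝ)) := by
      field_simp
      ring
    rw [e]
    gcongr
    linarith
end

section
/- Let S be a set of positive integers almost closed under addition and define the coefficients c_{t,i} as in the context. Then for all sufficiently small ε > 0 the following holds: for every integer m ≥ 2 and every r with 1 ≤ r ≤ m, there exists an integer k ≥ 2 (one may take k = 2) such that the quantity (m/(2t)) · Σ_{1 ≤ i ≤ t−(k−1)m, i ≡ r (mod m)} c_{t,i} c_{t,i+m} ⋯ c_{t,i+(k−1)m} does not converge to 1 as t → ∞. -/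
open Filter MeasureTheory Finset
open scoped Topology Classical

/-- Away from the index `1`, the coefficients lie in `[(1+ε)⁻¹, 1+ε]`. -/
theorem coeff_mem_Icc (S : Set ℕ) {ε : ℝ} (hε : 0 < ε) (t : ℕ) {i : ℕ} (hi : i ≠ 1) :
    coeff S ε t i ∈ Set.Icc (1 + ε)⁻¹ (1 + ε) := by
  have h1 : (1 + ε)⁻¹ ≤ 1 := inv_le_one_of_one_le₀ (by linarith)
  have h2 : (1 : ℝ) ≤ 1 + ε := by linarith
  unfold coeff indZ
  rw [if_neg hi]
  split_ifs <;> simp only [sub_self, zero_sub, sub_zero, zpow_zero, zpow_one, zpow_neg,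
    Set.mem_Icc] <;> constructor <;> linarith

theorem le_coeff_one (S : Set ℕ) {ε : ℝ} (hε : 0 < ε) (t : ℕ) : (t : ℝ) ≤ coeff S ε t 1 := by
  have ht : (0 : ℝ) ≤ t := t.cast_nonneg
  unfold coeff indZ
  rw [if_pos rfl]
  split_ifs <;> simp
  nlinarith

/-- The number of elements of a residue class mod `m` in `[1, n]` differs from `n / m`
by at most `1`. -/
theorem abs_card_residue_class_sub_le (n r : ℕ) {m : ℕ} (hm : 0 < m) :
    |(((Finset.Icc 1 n).filter fun i => i % m = r % m).card : ℝ) - (n : ℝ) / m| ≤ 1 := by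
  have hQ : |(((Finset.Icc 1 n).filter fun i => i % m = r % m).card : ℚ) - (n : ℚ) / m| ≤ 1 := by
    have h := Nat.Ioc_filter_modEq_card 0 n hm r
    have hI : (Finset.Icc 1 n) = Finset.Ioc 0 n := by ext; simp [Nat.succ_le_iff]
    have hc : (((Finset.Icc 1 n).filter fun i => i % m = r % m).card : ℤ) =
        max (⌊((n : ℚ) - r) / m⌋ - ⌊(((0 : ℕ) : ℚ) - r) / m⌋) 0 := by
      rw [hI, ← h]
      simp only [Nat.ModEq]
      congr!
    have hc := congrArg (Int.cast (R := ℚ)) hc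
    have hmQ : (0 : ℚ) < m := by exact_mod_cast hm
    have e : ((n : ℚ) - r) / m - ((0 : ℕ) - (r : ℚ)) / m = n / m := by field_simp; push_cast; ring
    have hn : (0 : ℚ) ≤ n / m := by positivity
    have a1 := Int.floor_le (((n : ℚ) - r) / m)
    have a2 := Int.lt_floor_add_one (((n : ℚ) - r) / m)
    have b1 := Int.floor_le ((((0 : ℕ) : ℚ) - r) / m)
    have b2 := Int.lt_floor_add_one ((((0 : ℕ) : ℚ) - r) / m)
    rw [Int.cast_natCast] at hc
    rw [hc, abs_le]
    push_cast at *
    rcases max_cases ((⌊((n : ℚ) - r) / m⌋ : ℚ) - ⌊((0 : ℚ) - r) / m⌋) 0 with ⟨h', _⟩ | ⟨h', _⟩ <;>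
      rw [h'] <;> constructor <;> linarith
  have h := (Rat.cast_le (K := ℝ)).2 hQ
  push_cast at h
  exact h

/-- For `S` almost closed under addition and all sufficiently small `ε > 0`: for every
`m ≥ 2` and `1 ≤ r ≤ m` there is `k ≥ 2` such that
`(m/(2t)) ∑_{1 ≤ i ≤ t-(k-1)m, i ≡ r (mod m)} c_{t,i} c_{t,i+m} ⋯ c_{t,i+(k-1)m}`
does not converge to `1` as `t → ∞`. -/
theorem stmt11 (S : Set ℕ) (hSpos : 0 ∉ S) (hS : AlmostClosed S) :
    ∃ ε₀ : ℝ, 0 < ε₀ ∧ ∀ ε : ℝ, 0 < ε → ε < ε₀ →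
      ∀ m : ℕ, 2 ≤ m → ∀ r : ℕ, 1 ≤ r → r ≤ m →
        ∃ k : ℕ, 2 ≤ k ∧
          ¬ Tendsto (fun t : ℕ =>
            (m : ℝ) / (2 * (t : ℝ)) *
              ∑ i ∈ (Finset.Icc 1 (t - (k - 1) * m)).filter (fun i => i % m = r % m),
                ∏ j ∈ Finset.range k, coeff S ε t (i + j * m)) atTop (𝓝 1) := by
  refine ⟨1 / 10, by norm_num, fun ε hε hε' m hm r hr hrm => ⟨2, le_rfl, fun hT => ?_⟩⟩
  simp only [Finset.prod_range_succ, Finset.prod_range_zero, one_mul, zero_mul, add_zero,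
    Nat.add_one_sub_one] at hT
  have hm0 : (0 : ℝ) < m := by exact_mod_cast (by lia : 0 < m)
  have hinv : (10 / 11 : ℝ) ≤ (1 + ε)⁻¹ := by
    rw [le_inv_comm₀ (by norm_num) (by linarith)]; linarith
  have hc : ∀ t i : ℕ, i ≠ 1 → 10 / 11 ≤ coeff S ε t i ∧ coeff S ε t i ≤ 11 / 10 := by
    intro t i hi
    have h := coeff_mem_Icc S hε t hi
    exact ⟨hinv.trans h.1, h.2.trans (by linarith)⟩
  have hcard : ∀ t : ℕ, m ≤ t → (t : ℝ) / m - 2 ≤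
        (((Finset.Icc 1 (t - m)).filter fun i => i % m = r % m).card : ℝ) ∧
      (((Finset.Icc 1 (t - m)).filter fun i => i % m = r % m).card : ℝ) ≤ (t : ℝ) / m := by
    intro t ht
    have h := abs_le.1 (abs_card_residue_class_sub_le (t - m) r (by lia : 0 < m))
    rw [Nat.cast_sub ht, sub_div, div_self hm0.ne'] at h
    constructor <;> linarith [h.1, h.2]
  rcases eq_or_ne r 1 with rfl | hr1
  · have hmem : ∀ t : ℕ, 10 * m ≤ t →
        1 ∈ (Finset.Icc 1 (t - m)).filter fun i => i % m = 1 % m := by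
      intro t ht
      simp only [Finset.mem_filter, Finset.mem_Icc, and_true]
      lia
    have hlow : ∀ᶠ t : ℕ in atTop, (11 / 10 : ℝ) ≤ (m : ℝ) / (2 * (t : ℝ)) *
        ∑ i ∈ (Finset.Icc 1 (t - m)).filter (fun i => i % m = 1 % m),
          coeff S ε t i * coeff S ε t (i + m) := by
      filter_upwards [eventually_ge_atTop (10 * m)] with t ht
      have htm : (10 : ℝ) * m ≤ t := by exact_mod_cast ht
      have ht0 : (0 : ℝ) < t := by linarith
      rw [← Finset.add_sum_erase _ _ (hmem t ht)]
      have hrest := Finset.card_nsmul_le_sum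
        (((Finset.Icc 1 (t - m)).filter fun i => i % m = 1 % m).erase 1)
        (fun i => coeff S ε t i * coeff S ε t (i + m)) (100 / 121) (by
          intro i hi
          have h1 := (hc t i (Finset.ne_of_mem_erase hi)).1
          have h2 := (hc t (i + m) (by lia)).1
          nlinarith)
      rw [nsmul_eq_mul, Finset.card_erase_of_mem (hmem t ht),
        Nat.cast_sub (Finset.card_pos.2 ⟨1, hmem t ht⟩)] at hrest
      have h1 := le_coeff_one S hε t
      have h2 := (hc t (1 + m) (by lia)).1
      have h3 : (t : ℝ) * (10 / 11) ≤ coeff S ε t 1 * coeff S ε t (1 + m) :=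
        mul_le_mul h1 h2 (by norm_num) (ht0.le.trans h1)
      have h4 := (hcard t (by lia)).1
      calc (11 / 10 : ℝ)
          ≤ (m : ℝ) / (2 * t) * (t * (10 / 11) + (t / m - 2 - 1) * (100 / 121)) := by
            have hm2 : (2 : ℝ) ≤ m := by exact_mod_cast hm
            have e : (m : ℝ) / (2 * t) * (t * (10 / 11) + (t / m - 2 - 1) * (100 / 121)) =
                m * (5 / 11) + 50 / 121 - m / t * (150 / 121) := by field_simp; ring
            have hq : (m : ℝ) / t ≤ 1 / 10 := by rw [div_le_iff₀ ht0]; linarith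
            rw [e]; linarith
        _ ≤ _ := by
            gcongr
            refine le_trans ?_ hrest
            push_cast
            gcongr
    linarith [ge_of_tendsto hT hlow]
  · have hup : ∀ᶠ t : ℕ in atTop, (m : ℝ) / (2 * (t : ℝ)) *
        ∑ i ∈ (Finset.Icc 1 (t - m)).filter (fun i => i % m = r % m),
          coeff S ε t i * coeff S ε t (i + m) ≤ 121 / 200 := by
      filter_upwards [eventually_ge_atTop m] with t ht
      have ht0 : (0 : ℝ) < t := hm0.trans_le (by exact_mod_cast ht)
      have hsum := Finset.sum_le_card_nsmul
        ((Finset.Icc 1 (t - m)).filter fun i => i % m = r % m)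
        (fun i => coeff S ε t i * coeff S ε t (i + m)) (121 / 100) (by
          intro i hi
          have hi1 : i ≠ 1 := by
            rintro rfl
            have h := (Finset.mem_filter.1 hi).2
            rw [Nat.mod_eq_of_lt (by lia : 1 < m)] at h
            rcases hrm.eq_or_lt with rfl | hlt
            · simp at h
            · exact hr1 (by rw [h, Nat.mod_eq_of_lt hlt])
          have h1 := hc t i hi1
          have h2 := hc t (i + m) (by lia)
          nlinarith [h1.1, h1.2, h2.1, h2.2])
      rw [nsmul_eq_mul] at hsum
      calc _ ≤ (m : ℝ) / (2 * t) * ((t : ℝ) / m * (121 / 100)) := by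
            gcongr
            exact hsum.trans (by gcongr; exact (hcard t ht).2)
        _ = 121 / 200 := by field_simp; norm_num
    linarith [le_of_tendsto hT hup]
end

section
/- If S is a set of positive integers almost closed under addition and k ∈ S, then the set {x ∈ S : x + k ∉ S} has asymptotic density 0; equivalently, #{x ≤ t : x ∈ S and x + k ∉ S} = o(t) as t → ∞. -/
open Filter MeasureTheory Finset
open scoped Topology Classical

/-- Counting the points of `S` in `[1, t + k]` and in `[1, t]` relates the number of exits from `S`
to the number of entries into `S` under the shift by `k`. -/
theorem card_exits_add_card (S : Set ℕ) (k t : ℕ) :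
    ((Finset.Icc 1 t).filter fun x => x ∈ S ∧ x + k ∉ S).card +
        ((Finset.Icc 1 (t + k)).filter fun x => x ∈ S).card =
      ((Finset.Icc 1 t).filter fun x => x ∉ S ∧ x + k ∈ S).card +
        ((Finset.Icc 1 t).filter fun x => x ∈ S).card +
        ((Finset.Icc 1 k).filter fun x => x ∈ S).card := by
  induction t with
  | zero => simp
  | succ t ih =>
    rw [Nat.add_right_comm t 1 k]
    simp only [Finset.card_filter] at ih ⊢
    simp only [Finset.sum_Icc_succ_top (Nat.le_add_left 1 _), Nat.add_right_comm t 1 k]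
    by_cases h₁ : t + 1 ∈ S <;> by_cases h₂ : t + k + 1 ∈ S <;>
      simp only [h₁, h₂, not_true_eq_false, not_false_eq_true, and_true, and_false, if_true,
        if_false] <;>
      omega

/-- Up to `k` boundary terms, the shift by `k` leaves `S` at most as often as it enters `S`. -/
theorem card_exits_le (S : Set ℕ) (k t : ℕ) :
    ((Finset.Icc 1 t).filter fun x => x ∈ S ∧ x + k ∉ S).card ≤
      ((Finset.Icc 1 t).filter fun x => x ∉ S ∧ x + k ∈ S).card + k := by
  have h := card_exits_add_card S k t
  have hmono : ((Finset.Icc 1 t).filter fun x => x ∈ S).card ≤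
      ((Finset.Icc 1 (t + k)).filter fun x => x ∈ S).card :=
    Finset.card_le_card (Finset.filter_subset_filter _
      (Finset.Icc_subset_Icc_right (Nat.le_add_right t k)))
  have hk : ((Finset.Icc 1 k).filter fun x => x ∈ S).card ≤ k :=
    (Finset.card_filter_le _ _).trans (by simp)
  omega

/-- If `S` is almost closed under addition and `k ∈ S`, then `{x ∈ S : x + k ∉ S}` has
asymptotic density `0`. -/
theorem stmt13 (S : Set ℕ) (hSpos : 0 ∉ S) (hS : AlmostClosed S) (k : ℕ) (hk : k ∈ S) :
    Tendsto
      (fun t : ℕ =>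
        (((Finset.Icc 1 t).filter fun x => x ∈ S ∧ x + k ∉ S).card : ℝ) / t)
      atTop (𝓝 0) := by
  have hlim := (hS k hk).add (tendsto_const_div_atTop_nhds_zero_nat (k : ℝ))
  rw [add_zero] at hlim
  refine squeeze_zero (fun t => by positivity) (fun t => ?_) hlim
  rw [← add_div]
  gcongr
  exact_mod_cast card_exits_le S k t
end

section
/- If Q is a basic sequence which is fully divergent and non-decreasing, then for every m ≥ 1, every r with 0 ≤ r ≤ m−1, and every k ≥ 1: (i) Q is (m,r)-divergent of type I, i.e., Σ_{i ≤ n, i ≡ r (mod m)} 1/(q_i q_{i+1} ⋯ q_{i+k−1}) → ∞ as n → ∞ (in particular Q_n^{(m,r)} → ∞), and (ii) Q is (k,m,r)-divergent of type II, i.e., Σ_{i ≤ n, i ≡ r (mod m)} 1/(q_i q_{i+m} ⋯ q_{i+(k−1)m}) → ∞ as n → ∞. -/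
open Filter MeasureTheory Finset
open scoped Topology Classical

/-- Over a residue class modulo `m`, the partial sums of a nonnegative antitone sequence with
divergent sum tend to infinity. -/
theorem tendsto_sum_filter_mod_atTop {f : ℕ → ℝ} (hf : Antitone f) (hf0 : ∀ n, 0 ≤ f n)
    (hsum : ¬ Summable f) {m r : ℕ} (hr : r < m) :
    Tendsto (fun n : ℕ => ∑ i ∈ (Finset.range n).filter (fun i => i % m = r), f i)
      atTop atTop := by
  have : NeZero m := ⟨by omega⟩
  have hns := (summable_indicator_mod_iff hf (r : ZMod m)).not.mpr hsum
  refine ((not_summable_iff_tendsto_nat_atTop_of_nonneg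
    (Set.indicator_nonneg fun n _ => hf0 n)).mp hns).congr fun n => ?_
  rw [Finset.sum_filter]
  refine Finset.sum_congr rfl fun i _ => ?_
  simp only [Set.indicator_apply, Set.mem_ofPred_eq, ZMod.natCast_eq_natCast_iff',
    Nat.mod_eq_of_lt hr]

/-- Along an arithmetic progression of difference `m`, a nonnegative antitone sequence with
divergent sum has divergent sum. -/
theorem not_summable_comp_mul_add {f : ℕ → ℝ} (hf : Antitone f) (hsum : ¬ Summable f)
    {m : ℕ} (hm : 0 < m) (r : ℕ) : ¬ Summable fun n => f (m * n + r) := by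
  have : NeZero m := ⟨hm.ne'⟩
  rw [← summable_indicator_mod_iff_summable]
  exact (summable_indicator_mod_iff hf (r : ZMod m)).not.mpr hsum

/-- The reciprocals of products of terms of a positive monotone sequence over a window of fixed
shape form an antitone sequence. -/
theorem antitone_inv_prod {Q : ℕ → ℕ} (hpos : ∀ n, 0 < Q n) (hmono : Monotone Q) (k : ℕ)
    (d : ℕ → ℕ) : Antitone fun i => (∏ j ∈ Finset.range k, (Q (i + d j) : ℝ))⁻¹ := by
  intro a b hab
  refine inv_anti₀ (Finset.prod_pos fun j _ => mod_cast hpos _) ?_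
  exact Finset.prod_le_prod (fun _ _ => Nat.cast_nonneg _)
    fun j _ => mod_cast hmono (by omega)

/-- For a positive monotone sequence, divergence of the sum of reciprocals of products of `k`
consecutive terms passes to products of `k` terms spaced `m` apart. -/
theorem not_summable_inv_prod_spaced {Q : ℕ → ℕ} (hpos : ∀ n, 0 < Q n) (hmono : Monotone Q)
    {k : ℕ} (hsum : ¬ Summable fun i => (∏ j ∈ Finset.range k, (Q (i + j) : ℝ))⁻¹) (m : ℕ) :
    ¬ Summable fun i => (∏ j ∈ Finset.range k, (Q (i + j * m) : ℝ))⁻¹ := by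
  intro h
  refine hsum ((summable_nat_add_iff (k * m)).mp (h.of_nonneg_of_le (fun i => by positivity)
    fun i => inv_anti₀ (Finset.prod_pos fun j _ => mod_cast hpos _) ?_))
  refine Finset.prod_le_prod (fun _ _ => Nat.cast_nonneg _) fun j hj => ?_
  have : j * m ≤ k * m := Nat.mul_le_mul_right m (Finset.mem_range.mp hj).le
  exact mod_cast hmono (by omega)

/-- If `Q` is a fully divergent, non-decreasing basic sequence, then for all `m ≥ 1`,
`0 ≤ r ≤ m-1` and `k ≥ 1`:
(i) `∑_{i ≤ n, i ≡ r (mod m)} 1/(q_i q_{i+1} ⋯ q_{i+k-1}) → ∞` (in particular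
`Q_n^{(m,r)} → ∞`), and
(ii) `∑_{i ≤ n, i ≡ r (mod m)} 1/(q_i q_{i+m} ⋯ q_{i+(k-1)m}) → ∞`. -/
theorem stmt14 (Q : ℕ → ℕ) (hQ : IsBasic Q) (hdiv : FullyDivergent Q)
    (hmono : Monotone Q) :
    ∀ m, 1 ≤ m → ∀ r, r < m → ∀ k, 1 ≤ k →
      (Tendsto (fun n : ℕ =>
          ∑ i ∈ (Finset.range n).filter (fun i => i % m = r),
            (∏ j ∈ Finset.range k, (Q (i + j) : ℝ))⁻¹) atTop atTop ∧
        Tendsto (fun n : ℕ => apQsum Q m r n) atTop atTop) ∧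
      Tendsto (fun n : ℕ =>
          ∑ i ∈ (Finset.range n).filter (fun i => i % m = r),
            (∏ j ∈ Finset.range k, (Q (i + j * m) : ℝ))⁻¹) atTop atTop := by
  intro m hm r hr k hk
  have hpos : ∀ n, 0 < Q n := fun n => two_pos.trans_le (hQ n)
  have hnonneg (l : ℕ) (d : ℕ → ℕ) (i : ℕ) :
      0 ≤ (∏ j ∈ Finset.range l, (Q (i + d j) : ℝ))⁻¹ := by positivity
  have hns (l : ℕ) (hl : 1 ≤ l) :
      ¬ Summable fun i => (∏ j ∈ Finset.range l, (Q (i + j) : ℝ))⁻¹ :=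
    (not_summable_iff_tendsto_nat_atTop_of_nonneg (hnonneg l id)).mpr (hdiv l hl)
  refine ⟨⟨?_, ?_⟩, ?_⟩
  · exact tendsto_sum_filter_mod_atTop (antitone_inv_prod hpos hmono k id) (hnonneg k id)
      (hns k hk) hr
  · have h := (not_summable_iff_tendsto_nat_atTop_of_nonneg
      fun n => hnonneg m id (m * n + r)).mp
      (not_summable_comp_mul_add (antitone_inv_prod hpos hmono m id) (hns m hm) hm r)
    exact h.comp <| (tendsto_add_atTop_nat 1).comp <|
      (Nat.tendsto_div_const_atTop (by omega)).comp (tendsto_sub_atTop_nat r)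
  · exact tendsto_sum_filter_mod_atTop (antitone_inv_prod hpos hmono k (· * m))
      (hnonneg k (· * m)) (not_summable_inv_prod_spaced hpos hmono (hns k hk) m) hr
end
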